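/- arXiv:1807.00222 — 8 statements merged into one kernel-verified Lean document; each statement's English description precedes it below -/
import Mathlib

section
/- Let X be a regular curve and f : X → X a homeomorphism such that ω_f(x) = α_f(x) for every x ∈ X. Then the map ω_f : X → 2^X, x ↦ ω_f(x), is continuous with respect to the Hausdorff metric on nonempty closed subsets of X. -/
open Set Filter Metric Topology

/-- The defining condition of a regular curve: every point has arbitrarily small
open neighborhoods with finite boundary. (Together with the instance assumptions
`Nonempty`, `CompactSpace`, `ConnectedSpace` on a metric space, this says `X` is a
regular curve.) -/
def regularCurveAx (X : Type*) [MetricSpace X] : Prop :=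
  ∀ (x : X) (V : Set X), IsOpen V → x ∈ V →
    ∃ U : Set X, IsOpen U ∧ x ∈ U ∧ U ⊆ V ∧ (frontier U).Finite

/-- The ω-limit set of `x` under `f`: all limits of `f^[n i] x` along a strictly
increasing sequence of integers `n`. -/
def omegaSet {X : Type*} [MetricSpace X] (f : X → X) (x : X) : Set X :=
  {y | ∃ n : ℕ → ℕ, StrictMono n ∧ Tendsto (fun i => f^[n i] x) atTop (𝓝 y)}

/-- `M` is a minimal set of `f`: nonempty, closed, strongly invariant, and without
any proper nonempty closed strongly invariant subset. -/
def IsMinimalSet {X : Type*} [MetricSpace X] (f : X → X) (M : Set X) : Prop :=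
  M.Nonempty ∧ IsClosed M ∧ f '' M = M ∧
    ∀ N : Set X, N ⊆ M → N.Nonempty → IsClosed N → f '' N = N → N = M

section Orbits

variable {X : Type*} [MetricSpace X] (f : X ≃ₜ X)

/-- The integer times at which the full orbit of `x` under `f` lies in `A`. -/
def visits (A : Set X) (x : X) : Set ℤ := {j | (f ^ j) x ∈ A}

theorem zpow_sub_apply (s t : ℤ) (x : X) : (f ^ (s - t)) ((f ^ t) x) = (f ^ s) x := by
  rw [← Homeomorph.mul_apply, ← zpow_add, sub_add_cancel]

theorem iterate_eq_zpow_apply (n : ℕ) (x : X) : f^[n] x = (f ^ (n : ℤ)) x := by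
  induction n generalizing x with
  | zero => simp
  | succ n ih =>
    rw [Function.iterate_succ_apply, ih, Nat.cast_succ, zpow_add, zpow_one, Homeomorph.mul_apply]

theorem symm_iterate_eq_zpow_apply (n : ℕ) (x : X) : f.symm^[n] x = (f ^ (-(n : ℤ))) x := by
  rw [iterate_eq_zpow_apply f.symm, zpow_neg, ← inv_zpow]
  rfl

theorem mem_omegaSet_iff_mapClusterPt (g : X → X) (x c : X) :
    c ∈ omegaSet g x ↔ MapClusterPt c atTop (fun n : ℕ => g^[n] x) := by
  constructor
  · rintro ⟨n, hn, hc⟩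
    exact hc.mapClusterPt.of_comp hn.tendsto_atTop
  · intro hc
    obtain ⟨n, hn, h⟩ := hc.tendsto_subseq
    exact ⟨n, hn, h⟩

theorem mem_omegaSet_iff (g : X → X) (x c : X) :
    c ∈ omegaSet g x ↔ ∀ V ∈ 𝓝 c, ∀ N : ℕ, ∃ n ≥ N, g^[n] x ∈ V := by
  rw [mem_omegaSet_iff_mapClusterPt, mapClusterPt_iff_frequently]
  simp only [frequently_atTop]

theorem omegaSet_nonempty [CompactSpace X] (g : X → X) (x : X) : (omegaSet g x).Nonempty := by
  obtain ⟨c, n, hn, h⟩ := CompactSpace.tendsto_subseq (fun n : ℕ => g^[n] x)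
  exact ⟨c, n, hn, h⟩

theorem isClosed_omegaSet (g : X → X) (x : X) : IsClosed (omegaSet g x) := by
  have : omegaSet g x = {c | MapClusterPt c atTop (fun n : ℕ => g^[n] x)} := by
    ext c
    exact mem_omegaSet_iff_mapClusterPt g x c
  rw [this]
  exact isClosed_setOfPred_clusterPt

variable {f} in
theorem zpow_apply_mem_omegaSet {x c : X} (hc : c ∈ omegaSet f x) (k : ℤ) :
    (f ^ k) c ∈ omegaSet f x := by
  rw [mem_omegaSet_iff] at hc ⊢
  intro V hV N
  obtain ⟨n, hn, hx⟩ := hc _ ((f ^ k).continuous.continuousAt hV) (N + k.natAbs)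
  refine ⟨(n + k).toNat, by omega, ?_⟩
  rw [iterate_eq_zpow_apply] at hx ⊢
  rw [Int.toNat_of_nonneg (by omega), add_comm, zpow_add]
  exact hx

variable {f} (h : ∀ x : X, omegaSet f x = omegaSet f.symm x)

include h in
theorem exists_visit_of_mem_omegaSet {x c : X} (hc : c ∈ omegaSet f x) {V : Set X} (hV : V ∈ 𝓝 c)
    (N : ℤ) : (∃ j ≥ N, j ∈ visits f V x) ∧ ∃ j ≤ N, j ∈ visits f V x := by
  constructor
  · obtain ⟨n, hn, hx⟩ := (mem_omegaSet_iff _ _ _).1 hc V hV N.toNat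
    rw [iterate_eq_zpow_apply] at hx
    exact ⟨n, by omega, hx⟩
  · rw [h] at hc
    obtain ⟨n, hn, hx⟩ := (mem_omegaSet_iff _ _ _).1 hc V hV (-N).toNat
    rw [symm_iterate_eq_zpow_apply] at hx
    exact ⟨-n, by omega, hx⟩

include h in
theorem visits_infinite_of_mem_omegaSet {x c : X} (hc : c ∈ omegaSet f x) {V : Set X}
    (hV : V ∈ 𝓝 c) : (visits f V x).Infinite := by
  refine Set.infinite_of_not_bddAbove ?_
  rintro ⟨N, hN⟩
  obtain ⟨j, hj, hx⟩ := (exists_visit_of_mem_omegaSet h hc hV (N + 1)).1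
  have := hN hx
  omega

include h in
theorem mem_omegaSet_of_visits_infinite {x c : X}
    (hc : ∀ V ∈ 𝓝 c, (visits f V x).Infinite) : c ∈ omegaSet f x := by
  by_contra hω
  have hα := hω
  rw [h] at hα
  rw [mem_omegaSet_iff] at hω hα
  push Not at hω hα
  obtain ⟨V, hV, N, hN⟩ := hω
  obtain ⟨W, hW, K, hK⟩ := hα
  refine hc _ (inter_mem hV hW) ((Set.finite_Icc (-(K : ℤ)) N).subset fun j hj => ?_)
  by_contra hj'
  rw [Set.mem_Icc, not_and_or] at hj'
  rcases hj' with hj' | hj'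
  · refine hK j.natAbs (by omega) ?_
    rw [symm_iterate_eq_zpow_apply, show -(j.natAbs : ℤ) = j by omega]
    exact hj.2
  · refine hN j.natAbs (by omega) ?_
    rw [iterate_eq_zpow_apply, show (j.natAbs : ℤ) = j by omega]
    exact hj.1

include h in
theorem visits_finite_of_disjoint_omegaSet [CompactSpace X] {x : X} {B : Set X} (hB : IsClosed B)
    (hd : omegaSet f x ∩ B = ∅) : (visits f B x).Finite := by
  by_contra hinf
  obtain ⟨c, hcB, hc⟩ := hB.isCompact.exists_mapClusterPt_of_frequently (l := cofinite)
    (f := fun j : ℤ => (f ^ j) x) (frequently_cofinite_iff_infinite.2 hinf)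
  rw [mapClusterPt_iff_frequently] at hc
  have : c ∈ omegaSet f x ∩ B :=
    ⟨mem_omegaSet_of_visits_infinite h fun V hV => frequently_cofinite_iff_infinite.1 (hc V hV),
      hcB⟩
  rw [hd] at this
  exact this

include h in
theorem mem_omegaSet_of_mem_closure_orbit {x c : X}
    (hc : c ∈ closure (range fun j : ℤ => (f ^ j) x)) (hne : ∀ j : ℤ, (f ^ j) x ≠ c) :
    c ∈ omegaSet f x := by
  refine mem_omegaSet_of_visits_infinite h fun V hV hfin => ?_
  have hfin' : ((fun j : ℤ => (f ^ j) x) '' visits f V x).Finite := hfin.image _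
  have hcn : c ∉ (fun j : ℤ => (f ^ j) x) '' visits f V x := by
    rintro ⟨j, -, hj⟩
    exact hne j hj
  obtain ⟨p, ⟨hpV, hp⟩, j, rfl⟩ := mem_closure_iff_nhds.1 hc _
    (inter_mem hV (hfin'.isClosed.isOpen_compl.mem_nhds hcn))
  exact hp ⟨j, hpV, rfl⟩

end Orbits

section FiniteFrontiers

variable {X : Type*}

/-- In a connected space, a proper nonempty finite intersection of closed sets has a point lying
on the frontier of one of them. -/
theorem exists_mem_frontier_of_biInter [TopologicalSpace X] [PreconnectedSpace X] {ι : Type*}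
    (T : Finset ι) (C : ι → Set X) (hC : ∀ i ∈ T, IsClosed (C i))
    (hne : (⋂ i ∈ T, C i).Nonempty) (hT : (⋂ i ∈ T, C i) ≠ univ) :
    ∃ i ∈ T, ∃ a ∈ frontier (C i), ∀ j ∈ T, a ∈ C j := by
  obtain ⟨a, ha⟩ := nonempty_frontier_iff.2 ⟨hne, hT⟩
  have haC : ∀ j ∈ T, a ∈ C j := by
    simpa using (isClosed_biInter hC).frontier_subset ha
  by_contra! hcon
  refine ha.2 ?_
  rw [Finset.interior_iInter]
  refine mem_iInter₂.2 fun i hi => ?_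
  by_contra hint
  obtain ⟨j, hj, hj'⟩ := hcon i hi a ⟨subset_closure (haC i hi), hint⟩
  exact hj' (haC j hj)

theorem exists_forall_of_antitone_of_finite {α : Type*} {s : Set α} (hs : s.Finite)
    {P : ℕ → α → Prop} (hP : ∀ m n a, m ≤ n → P n a → P m a) (hex : ∀ n, ∃ a ∈ s, P n a) :
    ∃ a ∈ s, ∀ n, P n a := by
  by_contra! hcon
  choose! k hk using hcon
  obtain ⟨N, hN⟩ := (hs.image k).bddAbove
  obtain ⟨a, ha, hPa⟩ := hex N
  exact hk a ha (hP _ _ a (hN (mem_image_of_mem k ha)) hPa)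

theorem regularCurveAx.exists_isOpen_between [MetricSpace X] [CompactSpace X]
    (hreg : regularCurveAx X) {K V : Set X} (hK : IsClosed K) (hV : IsOpen V) (hKV : K ⊆ V) :
    ∃ U, IsOpen U ∧ K ⊆ U ∧ closure U ⊆ V ∧ (frontier U).Finite := by
  obtain ⟨W, hW, hKW, hWV⟩ := normal_exists_closure_subset hK hV hKV
  suffices ∃ U, IsOpen U ∧ K ⊆ U ∧ U ⊆ W ∧ (frontier U).Finite by
    obtain ⟨U, h1, h2, h3, h4⟩ := this
    exact ⟨U, h1, h2, (closure_mono h3).trans hWV, h4⟩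
  refine hK.isCompact.induction_on (p := fun K => ∃ U, IsOpen U ∧ K ⊆ U ∧ U ⊆ W ∧
    (frontier U).Finite) ⟨∅, by simp⟩ ?_ ?_ ?_
  · rintro s t hst ⟨U, h1, h2, h3⟩
    exact ⟨U, h1, hst.trans h2, h3⟩
  · rintro s t ⟨U, hU, hsU, hUW, hf⟩ ⟨U', hU', hsU', hUW', hf'⟩
    exact ⟨U ∪ U', hU.union hU', union_subset_union hsU hsU', union_subset hUW hUW',
      (hf.union hf').subset ((frontier_union_subset _ _).trans
        (union_subset_union inter_subset_left inter_subset_right))⟩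
  · intro x hx
    obtain ⟨U, hU, hxU, hUW, hf⟩ := hreg x W hW (hKW hx)
    exact ⟨U, mem_nhdsWithin_of_mem_nhds (hU.mem_nhds hxU), U, hU, Subset.rfl, hUW, hf⟩

theorem regularCurveAx.exists_separating_pair [MetricSpace X] [CompactSpace X]
    (hreg : regularCurveAx X) {K V : Set X} (hK : IsClosed K) (hV : IsOpen V) (hKV : K ⊆ V) :
    ∃ A B : Set X, IsClosed A ∧ IsClosed B ∧ (frontier A).Finite ∧ (frontier B).Finite ∧
      Disjoint A B ∧ K ⊆ interior A ∧ Vᶜ ⊆ interior B := by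
  obtain ⟨U, hU, hKU, hUV, hUf⟩ := hreg.exists_isOpen_between hK hV hKV
  obtain ⟨W, hW, hKW, hWU, hWf⟩ := hreg.exists_isOpen_between hK hU hKU
  refine ⟨closure W, Uᶜ, isClosed_closure, hU.isClosed_compl, hWf.subset frontier_closure_subset,
    by rwa [frontier_compl], disjoint_compl_right_iff_subset.2 hWU,
    hKW.trans (hW.subset_interior_iff.2 subset_closure), ?_⟩
  rw [interior_compl]
  exact compl_subset_compl.2 hUV

end FiniteFrontiers

section Shadowing

variable {X : Type*} [MetricSpace X] {f : X ≃ₜ X} {A B : Set X}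

/-- Every long enough time interval that `x` spends in `A` is, after translation by `-τ`, also
spent in `A` by `a`. -/
def ShiftsVisits (f : X ≃ₜ X) (A : Set X) (L : ℤ) (x : X) (τ : ℤ) (a : X) : Prop :=
  ∀ l r : ℤ, L ≤ r - l → Icc l r ⊆ visits f A x → Icc (l - τ) (r - τ) ⊆ visits f A a

/-- `x` stays in `A` for arbitrarily long time intervals arbitrarily far in the future and in the
past. -/
def HasFarVisits (f : X ≃ₜ X) (A : Set X) (x : X) : Prop :=
  ∀ N : ℤ, (∃ l ≥ N, Icc l (l + N) ⊆ visits f A x) ∧ ∃ r ≤ -N, Icc (r - N) r ⊆ visits f A x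

theorem ShiftsVisits.refl (L : ℤ) (x : X) : ShiftsVisits f A L x 0 x := by
  intro l r _ h
  simpa using h

theorem ShiftsVisits.trans {L σ τ : ℤ} {x y z : X} (h₁ : ShiftsVisits f A L x σ y)
    (h₂ : ShiftsVisits f A L y τ z) : ShiftsVisits f A L x (σ + τ) z := by
  intro l r hlr h
  have := h₂ (l - σ) (r - σ) (by omega) (h₁ l r hlr h)
  rwa [sub_sub, sub_sub] at this

theorem ShiftsVisits.nat_mul {L τ : ℤ} {x : X} (h : ShiftsVisits f A L x τ x) (k : ℕ) :
    ShiftsVisits f A L x (k * τ) x := by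
  induction k with
  | zero => simpa using ShiftsVisits.refl L x
  | succ k ih =>
    rw [Nat.cast_succ, add_mul, one_mul]
    exact ih.trans h

theorem HasFarVisits.of_shiftsVisits {L τ : ℤ} {x a : X} (hx : HasFarVisits f A x)
    (h : ShiftsVisits f A L x τ a) : HasFarVisits f A a := by
  intro N
  obtain ⟨⟨l, hl, hl'⟩, r, hr, hr'⟩ := hx (|N| + |L| + |τ|)
  have hN := le_abs_self N
  have hL := le_abs_self L
  have hτ := le_abs_self τ
  have hτ' := neg_abs_le τ
  have h0 := abs_nonneg N
  have h1 := abs_nonneg L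
  refine ⟨⟨l - τ, by omega, ?_⟩, r - τ, by omega, ?_⟩
  · exact (Icc_subset_Icc le_rfl (by omega)).trans (h _ _ (by omega) hl')
  · exact (Icc_subset_Icc (by omega) le_rfl).trans (h _ _ (by omega) hr')

theorem not_shiftsVisits_self {L τ : ℤ} {a : X} (ha : a ∉ A) (hfar : HasFarVisits f A a)
    (hτ : τ ≠ 0) : ¬ ShiftsVisits f A L a τ a := by
  intro h
  have h0 : (0 : ℤ) ∉ visits f A a := by simpa [visits] using ha
  have hL := le_abs_self L
  have hL0 := abs_nonneg L
  have hτ0 := abs_nonneg τ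
  obtain ⟨⟨l, hl, hl'⟩, r, hr, hr'⟩ := hfar (|L| + |τ|)
  rcases lt_or_gt_of_ne hτ with hneg | hpos
  · rw [abs_of_neg hneg] at *
    have hdiv := Int.emod_add_mul_ediv (-r) (-τ)
    have hnn := Int.emod_nonneg (-r) (b := -τ) (by omega)
    have hlt := Int.emod_lt_of_pos (-r) (b := -τ) (by omega)
    have hq : 0 ≤ (-r) / (-τ) := Int.ediv_nonneg (by omega) (by omega)
    have hk : (((-r) / (-τ)).toNat + 1 : ℕ) * τ = -(-τ * ((-r) / (-τ))) + τ := by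
      push_cast
      rw [Int.toNat_of_nonneg hq]
      ring
    refine h0 (h.nat_mul (((-r) / (-τ)).toNat + 1) _ _ (by omega) hr' ?_)
    rw [hk]
    constructor <;> omega
  · rw [abs_of_pos hpos] at *
    have hdiv := Int.emod_add_mul_ediv l τ
    have hnn := Int.emod_nonneg l (b := τ) (by omega)
    have hlt := Int.emod_lt_of_pos l (b := τ) (by omega)
    have hq : 0 ≤ l / τ := Int.ediv_nonneg (by omega) (by omega)
    have hk : ((l / τ).toNat + 1 : ℕ) * τ = τ * (l / τ) + τ := by
      push_cast
      rw [Int.toNat_of_nonneg hq]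
      ring
    refine h0 (h.nat_mul ((l / τ).toNat + 1) _ _ (by omega) hl' ?_)
    rw [hk]
    constructor <;> omega

theorem exists_finset_pairwise_le_abs_sub {R : Set ℤ} (hR : R.Infinite) (J : ℤ) (k : ℕ) :
    ∃ S : Finset ℤ, S.card = k ∧ (S : Set ℤ) ⊆ R ∧
      (S : Set ℤ).Pairwise fun s t => J ≤ |s - t| := by
  induction k with
  | zero => exact ⟨∅, by simp⟩
  | succ k ih =>
    obtain ⟨S, hk, hS, hJ⟩ := ih
    obtain ⟨r, hr, hrS⟩ := hR.exists_notMem_finite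
      (S.finite_toSet.biUnion fun s _ => Set.finite_Icc (s - |J|) (s + |J|))
    have hfar : ∀ s ∈ S, |J| < |r - s| := by
      intro s hs
      by_contra! hle
      rw [abs_le] at hle
      exact hrS (mem_biUnion (Finset.mem_coe.2 hs) ⟨by omega, by omega⟩)
    have hrS' : r ∉ S := fun hmem => by
      have hlt := hfar r hmem
      rw [sub_self, abs_zero] at hlt
      exact hlt.not_ge (abs_nonneg J)
    refine ⟨insert r S, by rw [Finset.card_insert_of_notMem hrS', hk], ?_, ?_⟩
    · rw [Finset.coe_insert]
      exact insert_subset hr hS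
    · rw [Finset.coe_insert]
      refine hJ.insert fun s hs _ => ?_
      have := hfar s hs
      have := le_abs_self J
      rw [abs_sub_comm s r]
      constructor <;> omega

theorem eventually_subset_visits {x : X} {N : Set ℤ} (hN : N.Finite)
    (hx : ∀ j ∈ N, (f ^ j) x ∈ interior A) : ∀ᶠ p in 𝓝 x, N ⊆ visits f A p := by
  refine (eventually_all_finite hN).2 fun j hj => ?_
  exact (f ^ j).continuous.continuousAt (mem_interior_iff_mem_nhds.1 (hx j hj))

theorem visits_zpow_apply (n j : ℤ) (x : X) :
    j ∈ visits f A ((f ^ n) x) ↔ j + n ∈ visits f A x := by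
  rw [visits, visits, mem_ofPred, mem_ofPred, zpow_add, Homeomorph.mul_apply]

variable [CompactSpace X] [ConnectedSpace X] (h : ∀ x : X, omegaSet f x = omegaSet f.symm x)

include h in
theorem exists_shadowing_constants (hA : IsClosed A) (hB : IsClosed B)
    (hAf : (frontier A).Finite) (hBf : (frontier B).Finite) (hAB : Disjoint A B)
    (hAne : A.Nonempty) :
    ∃ J L : ℤ, ∀ (x : X) (S : Finset ℤ), S.Nontrivial → (S : Set ℤ) ⊆ visits f B x →
      ((S : Set ℤ).Pairwise fun s t => J ≤ |s - t|) →
      ∃ t ∈ S, ∃ a ∈ frontier B, (omegaSet f a ∩ B).Nonempty ∧ (∀ s ∈ S, s - t ∈ visits f B a) ∧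
        ShiftsVisits f A L x t a := by
  have hG := hAf.union hBf
  obtain ⟨J, hJ⟩ : ∃ J : ℤ, ∀ a ∈ frontier A ∪ frontier B, omegaSet f a ∩ B = ∅ →
      ∀ j ∈ visits f B a, |j| < J := by
    refine ((eventually_all_finite hG).2 fun a _ => ?_ : ∀ᶠ J : ℤ in atTop, _).exists
    by_cases hω : omegaSet f a ∩ B = ∅
    · obtain ⟨K, hK⟩ := ((visits_finite_of_disjoint_omegaSet h hB hω).image abs).bddAbove
      filter_upwards [eventually_gt_atTop K] with J hKJ _ j hj
      exact (hK (mem_image_of_mem _ hj)).trans_lt hKJ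
    · exact Eventually.of_forall fun J hω' => absurd hω' hω
  obtain ⟨L, hL⟩ : ∃ L : ℤ, ∀ a ∈ frontier A ∪ frontier B, (omegaSet f a ∩ B).Nonempty →
      (∃ j, 0 ≤ j ∧ j ≤ L ∧ j ∉ visits f A a) ∧ ∃ j, -L ≤ j ∧ j ≤ 0 ∧ j ∉ visits f A a := by
    refine ((eventually_all_finite hG).2 fun a _ => ?_ : ∀ᶠ L : ℤ in atTop, _).exists
    by_cases hω : (omegaSet f a ∩ B).Nonempty
    · obtain ⟨c, hc, hcB⟩ := hω
      obtain ⟨⟨j, hj, hja⟩, i, hi, hia⟩ := exists_visit_of_mem_omegaSet h hc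
        (hA.isOpen_compl.mem_nhds (disjoint_right.1 hAB hcB)) 0
      filter_upwards [eventually_ge_atTop j, eventually_ge_atTop (-i)] with L hjL hiL _
      exact ⟨⟨j, hj, hjL, hja⟩, i, by omega, hi, hia⟩
    · exact Eventually.of_forall fun L hω' => absurd hω' hω
  refine ⟨2 * J, 2 * L, fun x S hS hSx hSJ => ?_⟩
  suffices ∀ N : ℕ, ∃ p ∈ (S : Set ℤ) ×ˢ frontier B, (omegaSet f p.2 ∩ B).Nonempty ∧
      (∀ s ∈ S, s - p.1 ∈ visits f B p.2) ∧ ∀ l r : ℤ, -N ≤ l → r ≤ N → 2 * L ≤ r - l →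
        Icc l r ⊆ visits f A x → Icc (l - p.1) (r - p.1) ⊆ visits f A p.2 by
    obtain ⟨⟨t, a⟩, ⟨ht, ha⟩, hp⟩ := exists_forall_of_antitone_of_finite
      (S.finite_toSet.prod hBf) (fun m n p hmn hp =>
        ⟨hp.1, hp.2.1, fun l r hl hr => hp.2.2 l r (by omega) (by omega)⟩) this
    exact ⟨t, ht, a, ha, (hp 0).1, (hp 0).2.1, fun l r =>
      (hp (l.natAbs + r.natAbs)).2.2 l r (by omega) (by omega)⟩
  intro N
  classical
  let Q : Finset ℤ := (Finset.Icc (-N : ℤ) N).filter fun q =>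
    ∃ l r : ℤ, -N ≤ l ∧ r ≤ N ∧ 2 * L ≤ r - l ∧ Icc l r ⊆ visits f A x ∧ q ∈ Icc l r
  have hQ : ∀ l r : ℤ, -N ≤ l → r ≤ N → 2 * L ≤ r - l → Icc l r ⊆ visits f A x →
      ∀ q ∈ Icc l r, q ∈ Q := fun l r hl hr hlr hx q hq =>
    Finset.mem_filter.2 ⟨Finset.mem_Icc.2 ⟨hl.trans hq.1, hq.2.trans hr⟩, l, r, hl, hr, hlr, hx, hq⟩
  let C : ℤ ⊕ ℤ → Set X := Sum.elim (fun s => (f ^ s) ⁻¹' B) fun q => (f ^ q) ⁻¹' A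
  obtain ⟨s₀, hs₀, s₁, hs₁, hs₀₁⟩ := hS
  obtain ⟨i, hi, a₀, ha₀, hall⟩ := exists_mem_frontier_of_biInter (S.disjSum Q) C
    (by
      rintro (s | q) _
      · exact hB.preimage (f ^ s).continuous
      · exact hA.preimage (f ^ q).continuous)
    (by
      refine ⟨x, mem_iInter₂.2 ?_⟩
      rintro (s | q) hi
      · exact hSx (Finset.inl_mem_disjSum.1 hi)
      · obtain ⟨-, l, r, -, -, -, hx, hq⟩ := Finset.mem_filter.1 (Finset.inr_mem_disjSum.1 hi)
        exact hx hq)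
    (by
      obtain ⟨p, hp⟩ := hAne
      refine (ne_univ_iff_exists_notMem _).2 ⟨(f ^ (-s₀)) p, fun hmem => ?_⟩
      have hmem := mem_iInter₂.1 hmem (Sum.inl s₀) (Finset.inl_mem_disjSum.2 hs₀)
      have hmem : (f ^ s₀) ((f ^ (-s₀)) p) ∈ B := hmem
      rw [← Homeomorph.mul_apply, ← zpow_add, add_neg_cancel, zpow_zero] at hmem
      exact disjoint_left.1 hAB hp hmem)
  have hSa : ∀ t : ℤ, ∀ s ∈ S, s - t ∈ visits f B ((f ^ t) a₀) := by
    intro t s hs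
    have := hall (Sum.inl s) (Finset.inl_mem_disjSum.2 hs)
    rw [visits, mem_ofPred, zpow_sub_apply]
    exact this
  have hQa : ∀ t : ℤ, ∀ q ∈ Q, q - t ∈ visits f A ((f ^ t) a₀) := by
    intro t s hs
    have := hall (Sum.inr s) (Finset.inr_mem_disjSum.2 hs)
    rw [visits, mem_ofPred, zpow_sub_apply]
    exact this
  have hω : ∀ t : ℤ, (f ^ t) a₀ ∈ frontier A ∪ frontier B →
      (omegaSet f ((f ^ t) a₀) ∩ B).Nonempty := by
    intro t ht
    by_contra hemp
    rw [not_nonempty_iff_eq_empty] at hemp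
    have h₀ := hJ _ ht hemp _ (hSa t s₀ hs₀)
    have h₁ := hJ _ ht hemp _ (hSa t s₁ hs₁)
    have h₂ := hSJ hs₀ hs₁ hs₀₁
    have h₃ := abs_sub_le s₀ t s₁
    rw [abs_sub_comm t s₁] at h₃
    omega
  rcases i with t | t
  · have ht := Finset.inl_mem_disjSum.1 hi
    have ha : (f ^ t) a₀ ∈ frontier B := by
      rw [← mem_preimage, Homeomorph.preimage_frontier]
      exact ha₀
    refine ⟨(t, (f ^ t) a₀), ⟨ht, ha⟩, hω t (Or.inr ha), hSa t, fun l r hl hr hlr hx j hj => ?_⟩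
    have := hQa t (j + t) (hQ l r hl hr hlr hx _ ⟨by linarith [hj.1], by linarith [hj.2]⟩)
    rwa [add_sub_cancel_right] at this
  · have ha : (f ^ t) a₀ ∈ frontier A := by
      rw [← mem_preimage, Homeomorph.preimage_frontier]
      exact ha₀
    obtain ⟨-, l, r, hl, hr, hlr, hx, ht⟩ := Finset.mem_filter.1 (Finset.inr_mem_disjSum.1 hi)
    have hstay : ∀ j, l ≤ j + t → j + t ≤ r → j ∈ visits f A ((f ^ t) a₀) := fun j h₁ h₂ => by
      simpa using hQa t (j + t) (hQ l r hl hr hlr hx _ ⟨h₁, h₂⟩)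
    obtain ⟨⟨j, hj₀, hjL, hj⟩, i, hiL, hi₀, hi⟩ := hL _ (Or.inl ha) (hω t (Or.inl ha))
    have := ht.1
    have := ht.2
    rcases le_total L (r - t) with hrt | hrt
    · exact absurd (hstay j (by omega) (by omega)) hj
    · exact absurd (hstay i (by omega) (by omega)) hi

include h in
theorem visits_finite_of_hasFarVisits (hA : IsClosed A) (hB : IsClosed B)
    (hAf : (frontier A).Finite) (hBf : (frontier B).Finite) (hAB : Disjoint A B)
    (hAne : A.Nonempty) {y : X} (hy : HasFarVisits f A y) : (visits f B y).Finite := by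
  by_contra hinf
  classical
  obtain ⟨J, L, hstep⟩ := exists_shadowing_constants h hA hB hAf hBf hAB hAne
  obtain ⟨S₀, hcard, hS₀, hJ⟩ :=
    exists_finset_pairwise_le_abs_sub hinf J (hBf.toFinset.card + 3)
  have key : ∀ n ≤ hBf.toFinset.card + 1, ∃ V : Finset X, V ⊆ hBf.toFinset ∧ V.card = n ∧
      ∃ S ⊆ S₀, S.card + n = hBf.toFinset.card + 3 ∧ ∃ (σ : ℤ) (a : X), HasFarVisits f A a ∧
        (∀ s ∈ S, s - σ ∈ visits f B a) ∧ ∀ g ∈ V, ∃ ρ ∉ S, ShiftsVisits f A L g (σ - ρ) a := by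
    intro n hn
    induction n with
    | zero =>
      exact ⟨∅, by simp, rfl, S₀, Subset.rfl, hcard, 0, y, hy,
        fun s hs => by simpa using hS₀ hs, by simp⟩
    | succ n ih =>
      obtain ⟨V, hV, hVn, S, hSS₀, hSn, σ, a, hfar, hSa, hVa⟩ := ih (by omega)
      obtain ⟨t, ht, b, hb, -, hSb, hshift⟩ := hstep a (S.image (· - σ))
        (by
          rw [← Finset.one_lt_card_iff_nontrivial,
            Finset.card_image_of_injective _ (sub_left_injective)]
          omega)
        (by
          intro _ hs
          obtain ⟨s, hsS, rfl⟩ := Finset.mem_image.1 (Finset.mem_coe.1 hs)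
          exact hSa s hsS)
        (by
          intro _ hs _ hs' hne
          obtain ⟨s, hsS, rfl⟩ := Finset.mem_image.1 (Finset.mem_coe.1 hs)
          obtain ⟨s', hsS', rfl⟩ := Finset.mem_image.1 (Finset.mem_coe.1 hs')
          have := hJ (hSS₀ hsS) (hSS₀ hsS') (fun heq => hne (by rw [heq]))
          simpa using this)
      obtain ⟨σ', hσ', rfl⟩ := Finset.mem_image.1 ht
      have hbfar := hfar.of_shiftsVisits hshift
      have hbA : b ∉ A := disjoint_right.1 hAB (hB.frontier_subset hb)
      have hVb : ∀ g ∈ V, ∃ ρ ∉ S, ShiftsVisits f A L g (σ' - ρ) b := by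
        intro g hg
        obtain ⟨ρ, hρ, hga⟩ := hVa g hg
        refine ⟨ρ, hρ, ?_⟩
        have := hga.trans hshift
        rwa [show σ - ρ + (σ' - σ) = σ' - ρ by ring] at this
      have hbV : b ∉ V := by
        intro hbV
        obtain ⟨ρ, hρ, hbb⟩ := hVb b hbV
        have hne : σ' ≠ ρ := fun heq => hρ (heq ▸ hσ')
        exact not_shiftsVisits_self hbA hbfar (sub_ne_zero.2 hne) hbb
      refine ⟨insert b V, Finset.insert_subset (hBf.mem_toFinset.2 hb) hV,
        by rw [Finset.card_insert_of_notMem hbV, hVn], S.erase σ',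
        (Finset.erase_subset _ _).trans hSS₀, ?_, σ', b, hbfar, ?_, ?_⟩
      · have := Finset.card_erase_add_one hσ'
        omega
      · intro s hs
        have := hSb (s - σ) (Finset.mem_image_of_mem _ (Finset.mem_of_mem_erase hs))
        rwa [sub_sub_sub_cancel_right] at this
      · intro g hg
        rcases Finset.mem_insert.1 hg with rfl | hg
        · refine ⟨σ', Finset.notMem_erase _ _, ?_⟩
          rw [sub_self]
          exact ShiftsVisits.refl L g
        · obtain ⟨ρ, hρ, hgb⟩ := hVb g hg
          exact ⟨ρ, fun hmem => hρ (Finset.mem_of_mem_erase hmem), hgb⟩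
  obtain ⟨V, hV, hVn, -⟩ := key _ le_rfl
  have := Finset.card_le_card hV
  omega

include h in
theorem omegaSet_subset_closure_orbit (hreg : regularCurveAx X) {y c : X}
    (hc : c ∈ omegaSet f y) : omegaSet f y ⊆ closure (range fun j : ℤ => (f ^ j) c) := by
  intro z hz
  by_contra hzc
  obtain ⟨A, B, hA, hB, hAf, hBf, hAB, hKA, hzB⟩ := hreg.exists_separating_pair
    isClosed_closure isOpen_compl_singleton (subset_compl_singleton_iff.2 hzc)
  rw [compl_compl, singleton_subset_iff] at hzB
  have hcA : ∀ j : ℤ, (f ^ j) c ∈ interior A := fun j => hKA (subset_closure ⟨j, rfl⟩)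
  refine visits_infinite_of_mem_omegaSet h hz (mem_interior_iff_mem_nhds.1 hzB)
    (visits_finite_of_hasFarVisits h hA hB hAf hBf hAB ⟨_, interior_subset (hcA 0)⟩ fun N => ?_)
  have hev := eventually_subset_visits (Set.finite_Icc (-N) N) fun j _ => hcA j
  constructor
  · obtain ⟨n, hn, hny⟩ := (exists_visit_of_mem_omegaSet h hc hev N).1
    refine ⟨n, hn, fun j hj => ?_⟩
    have hj₁ := hj.1
    have hj₂ := hj.2
    have := (visits_zpow_apply n (j - n) y).1 (hny ⟨by omega, by omega⟩)
    rwa [sub_add_cancel] at this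
  · obtain ⟨n, hn, hny⟩ := (exists_visit_of_mem_omegaSet h hc hev (-N)).2
    refine ⟨n, hn, fun j hj => ?_⟩
    have hj₁ := hj.1
    have hj₂ := hj.2
    have := (visits_zpow_apply n (j - n) y).1 (hny ⟨by omega, by omega⟩)
    rwa [sub_add_cancel] at this

include h in
theorem exists_forall_visits_finite (hreg : regularCurveAx X) (hA : IsClosed A) (hB : IsClosed B)
    (hAf : (frontier A).Finite) (hBf : (frontier B).Finite) (hAB : Disjoint A B)
    (hAne : A.Nonempty) :
    ∃ J : ℕ, ∀ y, Icc (-J : ℤ) J ⊆ visits f A y → (visits f B y).Finite := by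
  by_contra! hcon
  choose y hyA hyB using hcon
  obtain ⟨J, L, hstep⟩ := exists_shadowing_constants h hA hB hAf hBf hAB hAne
  obtain ⟨a, haB, ha⟩ : ∃ a ∈ frontier B, ∀ n : ℕ, (omegaSet f a ∩ B).Nonempty ∧
      ∃ t : ℤ, Icc (-n - t) (n - t) ⊆ visits f A a := by
    refine exists_forall_of_antitone_of_finite hBf (fun m n a hmn => ?_) fun n => ?_
    · rintro ⟨hω, t, ht⟩
      exact ⟨hω, t, (Icc_subset_Icc (by omega) (by omega)).trans ht⟩
    · obtain ⟨S, hS, hSB, hSJ⟩ := exists_finset_pairwise_le_abs_sub (hyB (n + L.natAbs)) J 2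
      obtain ⟨t, -, a, ha, hω, -, hshift⟩ := hstep _ S
        (Finset.one_lt_card_iff_nontrivial.1 (by omega)) hSB hSJ
      refine ⟨a, ha, hω, t, (Icc_subset_Icc ?_ ?_).trans
        (hshift _ _ (by omega) (hyA (n + L.natAbs)))⟩ <;> omega
  have haA : a ∉ A := disjoint_right.1 hAB (hB.frontier_subset haB)
  obtain ⟨c, hc⟩ : (⋂ n : ℕ, closure (range fun j : ℤ => (f ^ j) a) ∩
      ⋂ j ∈ Icc (-n : ℤ) n, (f ^ j) ⁻¹' A).Nonempty := by
    have hcl : ∀ n : ℕ, IsClosed (closure (range fun j : ℤ => (f ^ j) a) ∩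
        ⋂ j ∈ Icc (-n : ℤ) n, (f ^ j) ⁻¹' A) := fun n =>
      isClosed_closure.inter (isClosed_biInter fun j _ => hA.preimage (f ^ j).continuous)
    refine IsCompact.nonempty_iInter_of_sequence_nonempty_isCompact_isClosed _ (fun n => ?_)
      (fun n => ?_) (hcl 0).isCompact hcl
    · exact inter_subset_inter_right _
        (biInter_subset_biInter_left (Icc_subset_Icc (by push_cast; omega) (by push_cast; omega)))
    · obtain ⟨t, ht⟩ := (ha n).2
      refine ⟨(f ^ (-t)) a, subset_closure ⟨-t, rfl⟩, mem_iInter₂.2 fun j hj => ?_⟩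
      have hj₁ := hj.1
      have hj₂ := hj.2
      exact (visits_zpow_apply (-t) j a).2 (ht ⟨by omega, by omega⟩)
  rw [mem_iInter] at hc
  have hcA : ∀ j : ℤ, (f ^ j) c ∈ A := fun j =>
    mem_iInter₂.1 (hc j.natAbs).2 j ⟨by omega, by omega⟩
  have hcω : c ∈ omegaSet f a := by
    refine mem_omegaSet_of_mem_closure_orbit h (hc 0).1 fun j hj => haA ?_
    have := hcA (-j)
    rwa [← hj, ← Homeomorph.mul_apply, ← zpow_add, neg_add_cancel, zpow_zero] at this
  obtain ⟨z, hz, hzB⟩ := (ha 0).1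
  refine disjoint_left.1 hAB ?_ hzB
  refine closure_minimal ?_ hA (omegaSet_subset_closure_orbit h hreg hcω hz)
  rintro _ ⟨j, rfl⟩
  exact hcA j

include h in
theorem eventually_omegaSet_subset (hreg : regularCurveAx X) {x : X} {V : Set X} (hV : IsOpen V)
    (hxV : omegaSet f x ⊆ V) : ∀ᶠ y in 𝓝 x, omegaSet f y ⊆ V := by
  obtain ⟨A, B, hA, hB, hAf, hBf, hAB, hKA, hVB⟩ :=
    hreg.exists_separating_pair (isClosed_omegaSet f x) hV hxV
  obtain ⟨c, hc⟩ := omegaSet_nonempty f x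
  obtain ⟨J, hJ⟩ := exists_forall_visits_finite h hreg hA hB hAf hBf hAB
    ⟨c, interior_subset (hKA hc)⟩
  have hev : ∀ᶠ p in 𝓝 c, Icc (-J : ℤ) J ⊆ visits f (interior A) p :=
    eventually_subset_visits (Set.finite_Icc _ _) fun j _ => by
      rw [interior_interior]
      exact hKA (zpow_apply_mem_omegaSet hc j)
  obtain ⟨n, -, hn⟩ := (exists_visit_of_mem_omegaSet h hc hev 0).1
  have hev' := (f ^ n).continuous.continuousAt.eventually
    (eventually_subset_visits (Set.finite_Icc _ _) hn)
  filter_upwards [hev'] with y hy z hz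
  by_contra hzV
  refine visits_infinite_of_mem_omegaSet h hz (mem_interior_iff_mem_nhds.1 (hVB hzV))
    (((hJ _ hy).image (· + n)).subset fun j hj => ⟨j - n, ?_, sub_add_cancel j n⟩)
  rw [visits_zpow_apply, sub_add_cancel]
  exact hj

include h in
theorem eventually_forall_exists_dist_lt (hreg : regularCurveAx X) (x : X) {ε : ℝ} (hε : 0 < ε) :
    ∀ᶠ y in 𝓝 x, ∀ z ∈ omegaSet f x, ∃ w ∈ omegaSet f y, dist z w < ε := by
  obtain ⟨T, hT, hTfin, hcover⟩ :=
    (isClosed_omegaSet f x).isCompact.finite_cover_balls (half_pos hε)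
  have hev : ∀ᶠ y in 𝓝 x, ∀ p ∈ T, omegaSet f y ⊆ ⋃ k : ℤ, (f ^ k) ⁻¹' ball p (ε / 2) := by
    refine (eventually_all_finite hTfin).2 fun p hp => eventually_omegaSet_subset h hreg
      (isOpen_iUnion fun k => isOpen_ball.preimage (f ^ k).continuous) fun c hc => ?_
    obtain ⟨_, hq, k, rfl⟩ := mem_closure_iff_nhds.1
      (omegaSet_subset_closure_orbit h hreg hc (hT hp)) _ (ball_mem_nhds p (half_pos hε))
    exact mem_iUnion.2 ⟨k, hq⟩
  filter_upwards [hev] with y hy z hz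
  obtain ⟨p, hp, hzp⟩ := mem_iUnion₂.1 (hcover hz)
  obtain ⟨c, hc⟩ := omegaSet_nonempty f y
  obtain ⟨k, hk⟩ := mem_iUnion.1 (hy p hp hc)
  refine ⟨(f ^ k) c, zpow_apply_mem_omegaSet hc k, ?_⟩
  have h₁ := mem_ball.1 hzp
  have h₂ := mem_ball'.1 hk
  linarith [dist_triangle z p ((f ^ k) c)]

end Shadowing

/-- If ω_f(x) = α_f(x) for every x, then x ↦ ω_f(x) is continuous with respect to
the Hausdorff metric. -/
theorem omegaMap_continuous_of_omega_eq_alpha {X : Type*} [MetricSpace X] [Nonempty X]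
    [CompactSpace X] [ConnectedSpace X] (hreg : regularCurveAx X) (f : X ≃ₜ X)
    (h : ∀ x : X, omegaSet (⇑f) x = omegaSet (⇑f.symm) x) :
    ∀ x : X, ∀ ε > 0, ∃ δ > 0, ∀ y : X, dist y x < δ →
      hausdorffDist (omegaSet (⇑f) y) (omegaSet (⇑f) x) < ε := by
  intro x ε hε
  have hupper := eventually_omegaSet_subset h hreg (isOpen_thickening (δ := ε / 2))
    (self_subset_thickening (half_pos hε) (omegaSet f x))
  obtain ⟨δ, hδ, hball⟩ := Metric.eventually_nhds_iff.1
    (hupper.and (eventually_forall_exists_dist_lt h hreg x (half_pos hε)))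
  refine ⟨δ, hδ, fun y hy => ?_⟩
  obtain ⟨hsub, hclose⟩ := hball hy
  refine (hausdorffDist_le_of_mem_dist (half_pos hε).le (fun w hw => ?_) fun z hz => ?_).trans_lt
    (half_lt_self hε)
  · obtain ⟨z, hz, hzw⟩ := mem_thickening_iff.1 (hsub hw)
    exact ⟨z, hz, hzw.le⟩
  · obtain ⟨w, hw, hzw⟩ := hclose z hz
    exact ⟨w, hw, hzw.le⟩
end

section
/- Let X be a hereditarily locally connected continuum and f : X → X a homeomorphism. Then every point x ∈ X that is not non-wandering (i.e. x ∈ X \ Ω(f)) is an equicontinuous point of the dynamical system (X, f). -/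
open Set Filter Metric Topology

/-- In a hereditarily locally connected compact space, a sequence of subcontinua which can be
separated from each other by open sets has diameters tending to zero. -/
theorem eventually_forall_dist_lt_of_hereditarilyLocallyConnected {X : Type*} [MetricSpace X]
    [CompactSpace X] [LocallyConnectedSpace X]
    (hhlc : ∀ C : Set X, IsClosed C → IsConnected C → LocallyConnectedSpace C)
    (C U : ℕ → Set X) (hclosed : ∀ n, IsClosed (C n)) (hconn : ∀ n, IsPreconnected (C n))
    (hopen : ∀ n, IsOpen (U n)) (hCU : ∀ n, C n ⊆ U n)
    (hdisj : ∀ m n, m ≠ n → Disjoint (U m) (C n)) {ε : ℝ} (hε : 0 < ε) :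
    ∀ᶠ n in atTop, ∀ y ∈ C n, ∀ z ∈ C n, dist y z < ε := by
  by_contra hcon
  obtain ⟨φ, hφ, hφC⟩ := extraction_of_frequently_atTop (not_eventually.mp hcon)
  push Not at hφC
  choose a ha b hb hab using hφC
  obtain ⟨⟨p, q⟩, ψ, hψ, hlim⟩ :=
    CompactSpace.tendsto_subseq (fun k => (a k, b k))
  have hp : Tendsto (fun k => a (ψ k)) atTop (𝓝 p) := (continuous_fst.tendsto _).comp hlim
  have hq : Tendsto (fun k => b (ψ k)) atTop (𝓝 q) := (continuous_snd.tendsto _).comp hlim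
  have hpq : ε ≤ dist p q := ge_of_tendsto' (hp.dist hq) fun k => hab (ψ k)
  set χ : ℕ → ℕ := fun k => φ (ψ k)
  have hχinj : Function.Injective χ := (hφ.comp hψ).injective
  obtain ⟨A, ⟨hAp, hAconn⟩, hAball⟩ :=
    (locallyConnectedSpace_iff_connected_basis.mp ‹_› p).mem_iff.mp
      (ball_mem_nhds p (by positivity : 0 < ε / 3))
  obtain ⟨k₀, hk₀⟩ := eventually_atTop.mp (hp hAp)
  set S : Set X := ⋃ k ∈ Ici k₀, C (χ k) with hS
  have hpA : p ∈ A := mem_of_mem_nhds hAp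
  have hconnAS : IsPreconnected (A ∪ S) := by
    have : A ∪ S = ⋃₀ ({A} ∪ (fun k => A ∪ C (χ k)) '' Ici k₀) := by
      ext t
      simp only [hS, mem_union, mem_iUnion, mem_sUnion, mem_singleton_iff, mem_image]
      constructor
      · rintro (h | ⟨k, hk, h⟩)
        · exact ⟨A, Or.inl rfl, h⟩
        · exact ⟨_, Or.inr ⟨k, hk, rfl⟩, Or.inr h⟩
      · rintro ⟨_, rfl | ⟨k, hk, rfl⟩, h⟩
        · exact Or.inl h
        · exact h.imp_right fun h => ⟨k, hk, h⟩
    rw [this]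
    refine isPreconnected_sUnion p _ ?_ ?_
    · rintro _ (rfl | ⟨k, -, rfl⟩)
      exacts [hpA, Or.inl hpA]
    · rintro _ (rfl | ⟨k, hk, rfl⟩)
      exacts [hAconn, hAconn.union (a (ψ k)) (hk₀ k hk) (ha (ψ k)) (hconn _)]
  set M := closure (A ∪ S) with hM
  have hbS : ∀ k, k₀ ≤ k → b (ψ k) ∈ S := fun k hk => mem_biUnion hk (hb (ψ k))
  have hSM : S ⊆ M := subset_union_right.trans subset_closure
  have hqM : q ∈ M := mem_closure_of_tendsto hq <|
    (eventually_ge_atTop k₀).mono fun k hk => Or.inr (hbS k hk)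
  have hloc := hhlc M isClosed_closure ⟨⟨q, hqM⟩, hconnAS.closure⟩
  obtain ⟨V, ⟨hVq, hVconn⟩, hVball⟩ :=
    (locallyConnectedSpace_iff_connected_basis.mp hloc ⟨q, hqM⟩).mem_iff.mp
      (ball_mem_nhds (⟨q, hqM⟩ : M) (by positivity : 0 < ε / 3))
  obtain ⟨W, hW, hWV⟩ := mem_nhds_subtype _ _ _ |>.mp hVq
  obtain ⟨k, hkW, hk⟩ := ((hq.eventually hW).and (eventually_ge_atTop k₀)).exists
  have hbV : (⟨b (ψ k), hSM (hbS k hk)⟩ : M) ∈ V := hWV hkW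
  have hVS : Subtype.val '' V ⊆ closure S := by
    rintro _ ⟨⟨v, hvM⟩, hv, rfl⟩
    rw [hM, closure_union] at hvM
    refine hvM.resolve_left fun hvA => ?_
    have h1 : dist v p ≤ ε / 3 :=
      closure_minimal (hAball.trans ball_subset_closedBall) isClosed_closedBall hvA
    have h2 : dist v q < ε / 3 := hVball hv
    linarith [dist_triangle_left p q v]
  have hUS : U (χ k) ∩ closure S ⊆ C (χ k) := by
    have hsub : S ⊆ C (χ k) ∪ (U (χ k))ᶜ := by
      refine iUnion₂_subset fun j _ => ?_
      rcases eq_or_ne k j with rfl | hkj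
      · exact subset_union_left
      · exact subset_union_of_subset_right (hdisj _ _ (hχinj.ne hkj)).subset_compl_left _
    rintro t ⟨htU, htS⟩
    exact (closure_minimal hsub ((hclosed _).union (hopen _).isClosed_compl) htS).resolve_right
      (not_not.mpr htU)
  have hVC : Subtype.val '' V ⊆ U (χ k) := by
    by_contra hnot
    obtain ⟨v, hvV, hvU⟩ := not_subset.mp hnot
    obtain ⟨t, htV, htU, htC⟩ := (hVconn.image _ continuous_subtype_val.continuousOn)
      (U (χ k)) (C (χ k))ᶜ (hopen _) (hclosed _).isOpen_compl
      (fun t _ => (em (t ∈ C (χ k))).imp (fun h => hCU _ h) id)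
      ⟨_, ⟨_, hbV, rfl⟩, hCU _ (hb (ψ k))⟩ ⟨v, hvV, fun h => hvU (hCU _ h)⟩
    exact htC (hUS ⟨htU, hVS htV⟩)
  have hqU : q ∈ U (χ k) := hVC ⟨_, mem_of_mem_nhds hVq, rfl⟩
  obtain ⟨j, hjU, hj⟩ := ((hq.eventually ((hopen _).mem_nhds hqU)).and (eventually_gt_atTop k)).exists
  exact (hdisj (χ k) (χ j) (hχinj.ne hj.ne)).le_bot ⟨hjU, hb (ψ j)⟩

/-- For a homeomorphism of a hereditarily locally connected continuum, every
point which is not non-wandering is an equicontinuity point. -/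
theorem equicontinuousAt_of_not_nonwandering {X : Type*} [MetricSpace X] [Nonempty X]
    [CompactSpace X] [ConnectedSpace X]
    (hhlc : ∀ C : Set X, IsClosed C → IsConnected C → LocallyConnectedSpace C)
    (f : X ≃ₜ X) (x : X)
    (hx : ¬ ∀ U : Set X, IsOpen U → x ∈ U →
      ∃ n : ℕ, 1 ≤ n ∧ ((⇑f)^[n] ⁻¹' U ∩ U).Nonempty) :
    ∀ ε > 0, ∃ δ > 0, ∀ y : X, dist x y < δ →
      ∀ n : ℕ, dist ((⇑f)^[n] x) ((⇑f)^[n] y) < ε := by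
  have hloc : LocallyConnectedSpace X := by
    have := hhlc univ isClosed_univ isConnected_univ
    exact (Homeomorph.Set.univ X).symm.isOpenEmbedding.locallyConnectedSpace
  intro ε hε
  push Not at hx
  obtain ⟨U, hU, hxU, hwander⟩ := hx
  obtain ⟨K, ⟨hKx, hK⟩, hKU⟩ := (closed_nhds_basis x).mem_iff.mp (hU.mem_nhds hxU)
  obtain ⟨B, ⟨hBx, hB⟩, hBK⟩ :=
    (locallyConnectedSpace_iff_connected_basis.mp hloc x).mem_iff.mp hKx
  have hCU : closure B ⊆ U := (closure_minimal hBK hK).trans hKU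
  have hcont : ∀ n : ℕ, Continuous (⇑f)^[n] := fun n => f.continuous.iterate n
  have hopen : ∀ n : ℕ, IsOpenMap (⇑f)^[n] := by
    intro n
    induction n with
    | zero => exact IsOpenMap.id
    | succ n ih => exact ih.comp f.isOpenMap
  have hiter : ∀ m n : ℕ, m < n → ∀ a ∈ U, ∀ b ∈ U, (⇑f)^[m] a ≠ (⇑f)^[n] b := by
    intro m n hmn a ha b hb hab
    obtain ⟨k, rfl⟩ := Nat.exists_eq_add_of_lt hmn
    rw [add_assoc, Function.iterate_add_apply] at hab
    have hmem : b ∈ (⇑f)^[k + 1] ⁻¹' U := by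
      rw [mem_preimage, ← f.injective.iterate m hab]
      exact ha
    exact (hwander (k + 1) (by omega)).le ⟨hmem, hb⟩
  have hsmall := eventually_forall_dist_lt_of_hereditarilyLocallyConnected hhlc
    (fun n => (⇑f)^[n] '' closure B) (fun n => (⇑f)^[n] '' U)
    (fun n => (isClosed_closure.isCompact.image (hcont n)).isClosed)
    (fun n => hB.closure.image _ (hcont n).continuousOn)
    (fun n => hopen n U hU)
    (fun n => image_mono hCU)
    (by
      intro m n hmn
      rw [Set.disjoint_left]
      rintro _ ⟨a, ha, rfl⟩ ⟨b, hb, hab⟩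
      rcases hmn.lt_or_gt with h | h
      · exact hiter m n h a ha b (hCU hb) hab.symm
      · exact hiter n m h b (hCU hb) a ha hab) hε
  obtain ⟨N, hN⟩ := eventually_atTop.mp hsmall
  have hfin : ∀ᶠ y in 𝓝 x, ∀ n ∈ Finset.range N, dist ((⇑f)^[n] x) ((⇑f)^[n] y) < ε := by
    refine (Filter.eventually_all_finset _).mpr fun n _ => ?_
    filter_upwards [(hcont n).continuousAt (ball_mem_nhds _ hε)] with y hy
    rw [dist_comm]
    exact hy
  obtain ⟨δ, hδ, hball⟩ := Metric.eventually_nhds_iff.mp (hfin.and hBx)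
  refine ⟨δ, hδ, fun y hy n => ?_⟩
  obtain ⟨h1, h2⟩ := hball (by rwa [dist_comm] : dist y x < δ)
  rcases lt_or_ge n N with hn | hn
  · exact h1 n (Finset.mem_range.mpr hn)
  · exact hN n hn _ (mem_image_of_mem _ (subset_closure (mem_of_mem_nhds hBx))) _
      (mem_image_of_mem _ (subset_closure h2))
end

section
/- Let X be a hereditarily locally connected continuum and f : X → X a homeomorphism. Then the map ω_f : X → 2^X, x ↦ ω_f(x), is continuous at every point of X \ Ω(f), with respect to the Hausdorff metric on nonempty closed subsets of X. -/
open Set Filter Metric Topology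

/-- A space all of whose subcontinua are locally connected is itself locally connected. -/
theorem locallyConnectedSpace_of_hereditarily {X : Type*} [TopologicalSpace X] [ConnectedSpace X]
    (hhlc : ∀ C : Set X, IsClosed C → IsConnected C → LocallyConnectedSpace C) :
    LocallyConnectedSpace X := by
  have := hhlc univ isClosed_univ isConnected_univ
  exact (Homeomorph.Set.univ X).symm.isOpenEmbedding.locallyConnectedSpace

/-- In a regular locally connected space, every neighborhood contains a closed connected
neighborhood. -/
theorem exists_isClosed_isPreconnected_mem_nhds {X : Type*} [TopologicalSpace X] [RegularSpace X]
    [LocallyConnectedSpace X] {x : X} {U : Set X} (hU : U ∈ 𝓝 x) :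
    ∃ K ∈ 𝓝 x, IsClosed K ∧ IsPreconnected K ∧ K ⊆ U := by
  obtain ⟨T, hT, hTc, hTU⟩ := exists_mem_nhds_isClosed_subset hU
  obtain ⟨V, hV, hVc, hVT⟩ := locallyConnectedSpace_iff_connected_subsets.1 ‹_› x T hT
  exact ⟨closure V, mem_of_superset hV subset_closure, isClosed_closure, hVc.closure,
    (closure_minimal hVT hTc).trans hTU⟩

/-- Separated disjoint closed connected sets in a hereditarily locally connected space cannot
accumulate along two different points. -/
theorem eq_of_tendsto_of_pairwise_disjoint {X : Type*} [MetricSpace X] [ConnectedSpace X]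
    (hhlc : ∀ C : Set X, IsClosed C → IsConnected C → LocallyConnectedSpace C)
    {K U : ℕ → Set X} (hKU : ∀ i, K i ⊆ U i) (hU : ∀ i, IsOpen (U i))
    (hdisj : Pairwise (Function.onFun Disjoint U)) (hK : ∀ i, IsClosed (K i))
    (hKc : ∀ i, IsPreconnected (K i)) {a b : ℕ → X} (ha : ∀ i, a i ∈ K i) (hb : ∀ i, b i ∈ K i)
    {p q : X} (hap : Tendsto a atTop (𝓝 p)) (hbq : Tendsto b atTop (𝓝 q)) : p = q := by
  by_contra hpq
  have := locallyConnectedSpace_of_hereditarily hhlc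
  obtain ⟨N, hN, hNcl, hNc, hNq⟩ :=
    exists_isClosed_isPreconnected_mem_nhds (isOpen_compl_singleton.mem_nhds hpq)
  obtain ⟨i₀, hi₀⟩ := eventually_atTop.1 (hap hN)
  set S : Set X := ⋃ i : {i // i₀ ≤ i}, K i
  have hKS : ∀ i, i₀ ≤ i → K i ⊆ S := fun i hi =>
    subset_iUnion (fun i : {i // i₀ ≤ i} => K i) ⟨i, hi⟩
  have hUS : ∀ i, U i ∩ closure S ⊆ K i := by
    rintro i z ⟨hzU, hzS⟩
    rw [← (hK i).closure_eq]
    refine closure_mono ?_ ((hU i).inter_closure ⟨hzU, hzS⟩)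
    rintro w ⟨hwU, hwS⟩
    obtain ⟨j, hj⟩ := mem_iUnion.1 hwS
    have hij : i = j := by
      by_contra hne
      exact (hdisj hne).le_bot ⟨hwU, hKU _ hj⟩
    exact hij ▸ hj
  have hC : IsConnected (closure (⋃ i : {i // i₀ ≤ i}, (N ∪ K i))) := by
    refine IsConnected.closure ⟨⟨p, mem_iUnion.2 ⟨⟨i₀, le_rfl⟩, .inl (mem_of_mem_nhds hN)⟩⟩, ?_⟩
    exact isPreconnected_iUnion ⟨p, mem_iInter.2 fun _ => .inl (mem_of_mem_nhds hN)⟩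
      fun i => hNc.union (a i) (hi₀ i i.2) (ha i) (hKc i)
  set C := closure (⋃ i : {i // i₀ ≤ i}, (N ∪ K i))
  have hCsub : C ⊆ N ∪ closure S := by
    refine closure_minimal (iUnion_subset fun i => union_subset_union_right N ?_)
      (hNcl.union isClosed_closure)
    exact (hKS i i.2).trans subset_closure
  have hKC : ∀ i, i₀ ≤ i → K i ⊆ C := fun i hi =>
    (subset_union_right.trans (subset_iUnion (fun i : {i // i₀ ≤ i} => N ∪ K i) ⟨i, hi⟩)).trans
      subset_closure
  have hqC : q ∈ C := isClosed_closure.mem_of_tendsto hbq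
    (eventually_atTop.2 ⟨i₀, fun i hi => hKC i hi (hb i)⟩)
  have hCl := hhlc C isClosed_closure hC
  have hNq' : q ∉ N := fun h => hNq h rfl
  obtain ⟨W, hW, hWc, hWN⟩ := locallyConnectedSpace_iff_connected_subsets.1 hCl ⟨q, hqC⟩
    (Subtype.val ⁻¹' Nᶜ) (continuous_subtype_val.continuousAt (hNcl.isOpen_compl.mem_nhds hNq'))
  obtain ⟨T, hT, hTW⟩ := mem_nhds_subtype _ _ _ |>.1 hW
  obtain ⟨i₁, hi₁⟩ := eventually_atTop.1 (hbq hT)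
  have hWK : ∀ i, i₀ ≤ i → i₁ ≤ i → W ⊆ Subtype.val ⁻¹' K i := by
    intro i h0 h1
    have hUK : W ∩ Subtype.val ⁻¹' U i ⊆ Subtype.val ⁻¹' K i := by
      rintro z ⟨hzW, hzU⟩
      exact hUS i ⟨hzU, (hCsub z.2).resolve_left (hWN hzW)⟩
    have hbW : (⟨b i, hKC i h0 (hb i)⟩ : C) ∈ W := hTW (hi₁ i h1)
    by_contra hnot
    obtain ⟨z, hzW, hzK⟩ := not_subset.1 hnot
    obtain ⟨w, hwW, hwU, hwK⟩ := hWc (Subtype.val ⁻¹' U i) (Subtype.val ⁻¹' (K i)ᶜ)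
      ((hU i).preimage continuous_subtype_val)
      ((hK i).isOpen_compl.preimage continuous_subtype_val)
      (fun w _ => (em ((w : X) ∈ K i)).imp (fun h => hKU i h) id)
      ⟨_, hbW, hKU i (hb i)⟩ ⟨z, hzW, hzK⟩
    exact hwK (hUK ⟨hwW, hwU⟩)
  have hqW : (⟨q, hqC⟩ : C) ∈ W := mem_of_mem_nhds hW
  have h1 := hWK (i₀ + i₁) (by omega) (by omega) hqW
  have h2 := hWK (i₀ + i₁ + 1) (by omega) (by omega) hqW
  exact (hdisj (show i₀ + i₁ ≠ i₀ + i₁ + 1 by omega)).le_bot ⟨hKU _ h1, hKU _ h2⟩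

/-- Points chosen in a sequence of separated disjoint closed connected subsets of a hereditarily
locally connected continuum are asymptotic. -/
theorem tendsto_dist_of_pairwise_disjoint {X : Type*} [MetricSpace X] [CompactSpace X]
    [ConnectedSpace X] (hhlc : ∀ C : Set X, IsClosed C → IsConnected C → LocallyConnectedSpace C)
    {K U : ℕ → Set X} (hKU : ∀ i, K i ⊆ U i) (hU : ∀ i, IsOpen (U i))
    (hdisj : Pairwise (Function.onFun Disjoint U)) (hK : ∀ i, IsClosed (K i))
    (hKc : ∀ i, IsPreconnected (K i)) {a b : ℕ → X} (ha : ∀ i, a i ∈ K i) (hb : ∀ i, b i ∈ K i) :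
    Tendsto (fun i => dist (a i) (b i)) atTop (𝓝 0) := by
  refine tendsto_of_subseq_tendsto fun ns hns => ?_
  obtain ⟨φ, hφ, hnsφ⟩ := strictMono_subseq_of_tendsto_atTop hns
  obtain ⟨⟨p, q⟩, ψ, hψ, hlim⟩ := CompactSpace.tendsto_subseq fun i => (a (ns (φ i)), b (ns (φ i)))
  have hinj : Function.Injective fun i => ns (φ (ψ i)) := (hnsφ.comp hψ).injective
  rw [nhds_prod_eq] at hlim
  have hap := tendsto_fst.comp hlim
  have hbq := tendsto_snd.comp hlim
  have hpq : p = q := eq_of_tendsto_of_pairwise_disjoint hhlc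
    (fun i => hKU (ns (φ (ψ i)))) (fun i => hU _) (fun i j hij => hdisj (hinj.ne hij))
    (fun i => hK _) (fun i => hKc _) (fun i => ha _) (fun i => hb _) hap hbq
  refine ⟨φ ∘ ψ, ?_⟩
  have hd := hap.dist hbq
  rwa [hpq, dist_self] at hd

/-- Asymptotic points have nested ω-limit sets. -/
theorem omegaSet_subset_of_tendsto_dist {X : Type*} [MetricSpace X] {f : X → X} {x y : X}
    (h : Tendsto (fun n => dist (f^[n] x) (f^[n] y)) atTop (𝓝 0)) :
    omegaSet f x ⊆ omegaSet f y := by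
  rintro z ⟨n, hn, hz⟩
  exact ⟨n, hn, (tendsto_iff_of_dist (h.comp hn.tendsto_atTop)).1 hz⟩

/-- For a homeomorphism of a hereditarily locally connected continuum, the map
x ↦ ω_f(x) is continuous (for the Hausdorff metric) at every point which is not
non-wandering. -/
theorem omegaMap_continuousAt_of_not_nonwandering {X : Type*} [MetricSpace X] [Nonempty X]
    [CompactSpace X] [ConnectedSpace X]
    (hhlc : ∀ C : Set X, IsClosed C → IsConnected C → LocallyConnectedSpace C)
    (f : X ≃ₜ X) (x : X)
    (hx : ¬ ∀ U : Set X, IsOpen U → x ∈ U →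
      ∃ n : ℕ, 1 ≤ n ∧ ((⇑f)^[n] ⁻¹' U ∩ U).Nonempty) :
    ∀ ε > 0, ∃ δ > 0, ∀ y : X, dist y x < δ →
      hausdorffDist (omegaSet (⇑f) y) (omegaSet (⇑f) x) < ε := by
  push Not at hx
  obtain ⟨U, hU, hxU, hwand⟩ := hx
  have := locallyConnectedSpace_of_hereditarily hhlc
  obtain ⟨K, hK, hKcl, hKc, hKU⟩ := exists_isClosed_isPreconnected_mem_nhds (hU.mem_nhds hxU)
  have hcont : ∀ n, Continuous (⇑f)^[n] := fun n => f.continuous.iterate n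
  have hopen : ∀ n, IsOpenMap (⇑f)^[n] := fun n => by
    induction n with
    | zero => exact IsOpenMap.id
    | succ n ih => exact ih.comp f.isOpenMap
  have hlt : ∀ i j, i < j → Disjoint ((⇑f)^[i] '' U) ((⇑f)^[j] '' U) := by
    intro i j hij
    rw [disjoint_left]
    rintro _ ⟨u, hu, rfl⟩ ⟨v, hv, hvu⟩
    obtain ⟨k, rfl⟩ := Nat.exists_eq_add_of_lt hij
    rw [add_assoc, Function.iterate_add_apply] at hvu
    have huv := f.injective.iterate i hvu
    have hmem : v ∈ (⇑f)^[k + 1] ⁻¹' U ∩ U := ⟨by rwa [mem_preimage, huv], hv⟩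
    rw [hwand (k + 1) (by omega)] at hmem
    exact hmem
  have hdisj : Pairwise (Function.onFun Disjoint fun n => (⇑f)^[n] '' U) := fun i j hij =>
    hij.lt_or_gt.elim (hlt i j) fun h => (hlt j i h).symm
  have hasymp : ∀ y ∈ K, ∀ z ∈ K,
      Tendsto (fun n => dist ((⇑f)^[n] y) ((⇑f)^[n] z)) atTop (𝓝 0) := fun y hy z hz =>
    tendsto_dist_of_pairwise_disjoint hhlc (K := fun n => (⇑f)^[n] '' K)
      (fun n => image_mono hKU) (fun n => hopen n U hU) hdisj
      (fun n => (hKcl.isCompact.image (hcont n)).isClosed)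
      (fun n => hKc.image _ (hcont n).continuousOn)
      (fun n => mem_image_of_mem _ hy) (fun n => mem_image_of_mem _ hz)
  have hxK := mem_of_mem_nhds hK
  intro ε hε
  obtain ⟨δ, hδ, hball⟩ := Metric.mem_nhds_iff.1 hK
  refine ⟨δ, hδ, fun y hy => ?_⟩
  have hyK : y ∈ K := hball hy
  rw [(omegaSet_subset_of_tendsto_dist (hasymp y hyK x hxK)).antisymm
    (omegaSet_subset_of_tendsto_dist (hasymp x hxK y hyK)), hausdorffDist_self_zero]
  exact hε
end

section
/- Let X be a regular curve and f : X → X a homeomorphism with no periodic points. Then f possesses exactly one minimal set. -/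
open Set Filter Metric Topology

section FrontierLemmas

variable {X : Type*} [TopologicalSpace X]

/-- Points in the frontiers of both `U ∩ V` and `U ∪ V` lie in both frontiers. -/
theorem frontier_inter_inter_frontier_union_subset {U V : Set X} (hU : IsOpen U)
    (hV : IsOpen V) :
    frontier (U ∩ V) ∩ frontier (U ∪ V) ⊆ frontier U ∩ frontier V := by
  rw [(hU.inter hV).frontier_eq, (hU.union hV).frontier_eq, hU.frontier_eq, hV.frontier_eq]
  rintro x ⟨⟨h1, -⟩, -, h2⟩
  exact ⟨⟨closure_mono inter_subset_left h1, fun h => h2 (Or.inl h)⟩,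
    closure_mono inter_subset_right h1, fun h => h2 (Or.inr h)⟩

theorem frontier_inter_union_frontier_union_subset (U V : Set X) :
    frontier (U ∩ V) ∪ frontier (U ∪ V) ⊆ frontier U ∪ frontier V := by
  refine union_subset ((frontier_inter_subset U V).trans ?_) ((frontier_union_subset U V).trans ?_)
  · exact union_subset_union inter_subset_left inter_subset_right
  · exact union_subset_union inter_subset_left inter_subset_right

/-- The number of frontier points is a submodular function of an open set. -/
theorem encard_frontier_inter_add_union_le {U V : Set X} (hU : IsOpen U) (hV : IsOpen V) :
    (frontier (U ∩ V)).encard + (frontier (U ∪ V)).encard ≤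
      (frontier U).encard + (frontier V).encard := by
  rw [← encard_union_add_encard_inter (frontier (U ∩ V)),
    ← encard_union_add_encard_inter (frontier U)]
  exact add_le_add (encard_le_encard (frontier_inter_union_frontier_union_subset U V))
    (encard_le_encard (frontier_inter_inter_frontier_union_subset hU hV))

/-- If the open sets `A n` increase and have no frontier points in a neighborhood `O` of `p`, then
`p` is not in the frontier of their union. -/
theorem notMem_frontier_iUnion_of_disjoint [PreconnectedSpace X] {A : ℕ → Set X}
    (hmono : Monotone A) (hopen : ∀ n, IsOpen (A n)) {O P : Set X} {p : X}
    (hdisj : ∀ n, Disjoint (frontier (A n)) O) (hP : IsOpen P) (hpP : p ∈ P)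
    (hPO : closure P ⊆ O) (hfin : (frontier P).Finite) :
    p ∉ frontier (⋃ n, A n) := by
  rw [(isOpen_iUnion hopen).frontier_eq]
  rintro ⟨hcl, hnot⟩
  have hclO : ∀ n, closure (A n) ∩ O ⊆ A n := by
    rintro n x ⟨hx, hxO⟩
    by_contra hxn
    exact disjoint_left.1 (hdisj n) ((hopen n).frontier_eq ▸ ⟨hx, hxn⟩) hxO
  obtain ⟨N, hN⟩ : ∃ N, ∀ n, frontier P ∩ A n ⊆ A N := by
    have hfin' := hfin.inter_of_left (⋃ n, A n)
    obtain ⟨N, hN⟩ := Directed.exists_mem_subset_of_finset_subset_biUnion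
      (s := hfin'.toFinset) hmono.directed_le (by simp)
    exact ⟨N, fun n x hx => hN (by simpa using ⟨hx.1, n, hx.2⟩)⟩
  have hstab : ∀ n, P ∩ A n ⊆ A N := by
    intro n
    have hclopen : IsClopen (P ∩ (A n \ closure (A N))) := by
      refine ⟨?_, hP.inter ((hopen n).sdiff isClosed_closure)⟩
      refine isClosed_of_closure_subset fun x hx => ?_
      have hxP : x ∈ closure P := closure_mono inter_subset_left hx
      have hxn : x ∈ A n :=
        hclO n ⟨closure_mono (inter_subset_right.trans sdiff_subset) hx, hPO hxP⟩
      have hxN : x ∉ A N := by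
        intro h
        obtain ⟨y, hy, -, -, hy'⟩ := mem_closure_iff.1 hx _ (hopen N) h
        exact hy' (subset_closure hy)
      refine ⟨?_, hxn, fun h => hxN (hclO N ⟨h, hPO hxP⟩)⟩
      by_contra h
      exact hxN (hN n ⟨hP.frontier_eq ▸ ⟨hxP, h⟩, hxn⟩)
    rcases isClopen_iff.1 hclopen with h | h
    · rintro x ⟨hxP, hxn⟩
      by_contra hxN
      have : x ∈ P ∩ (A n \ closure (A N)) :=
        ⟨hxP, hxn, fun h => hxN (hclO N ⟨h, hPO (subset_closure hxP)⟩)⟩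
      rw [h] at this
      exact this
    · have : p ∈ P ∩ (A n \ closure (A N)) := h ▸ mem_univ p
      exact absurd (mem_iUnion.2 ⟨n, this.2.1⟩) hnot
  refine hnot (mem_iUnion.2 ⟨N, hclO N ⟨?_, hPO (subset_closure hpP)⟩⟩)
  refine mem_closure_iff.2 fun G hG hpG => ?_
  obtain ⟨y, ⟨hyG, hyP⟩, hyA⟩ := mem_closure_iff.1 hcl (G ∩ P) (hG.inter hP) ⟨hpG, hpP⟩
  obtain ⟨n, hn⟩ := mem_iUnion.1 hyA
  exact ⟨y, hyG, hstab n ⟨hyP, hn⟩⟩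

end FrontierLemmas

section RegularCurve

variable {X : Type*} [MetricSpace X]

/-- In a connected regular space, an increasing union of open sets with at most `k` frontier points
has finite frontier. -/
theorem finite_frontier_iUnion [PreconnectedSpace X] (hreg : regularCurveAx X) {A : ℕ → Set X}
    (hmono : Monotone A) (hopen : ∀ n, IsOpen (A n)) {k : ℕ}
    (hk : ∀ n, (frontier (A n)).encard ≤ k) : (frontier (⋃ n, A n)).Finite := by
  by_contra hinf
  obtain ⟨t, htsub, htcard⟩ := Set.Infinite.exists_subset_card_eq hinf (k + 1)
  obtain ⟨O, hO, hOdisj⟩ := t.finite_toSet.t2_separation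
  have hex : ∀ n, ∃ p ∈ t, Disjoint (frontier (A n)) (O p) := by
    intro n
    by_contra! h
    have h' : ∀ p : X, ∃ x, p ∈ t → x ∈ frontier (A n) ∧ x ∈ O p := by
      intro p
      by_cases hp : p ∈ t
      · obtain ⟨x, hx⟩ := not_disjoint_iff.1 (h p hp)
        exact ⟨x, fun _ => hx⟩
      · exact ⟨p, fun h => absurd h hp⟩
    choose g hg using h'
    have hinj : InjOn g (t : Set X) := by
      intro p hp q hq hpq
      by_contra hne
      exact disjoint_left.1 (hOdisj hp hq hne) (hg p hp).2 (hpq ▸ (hg q hq).2)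
    have hle : (t : Set X).encard ≤ k := by
      rw [← hinj.encard_image]
      exact (encard_le_encard (image_subset_iff.2 fun p hp => (hg p hp).1)).trans (hk n)
    rw [encard_coe_eq_coe_finsetCard, htcard] at hle
    exact absurd (by exact_mod_cast hle : k + 1 ≤ k) (by omega)
  obtain ⟨p, hp, hfreq⟩ : ∃ p ∈ t, ∃ᶠ n in atTop, Disjoint (frontier (A n)) (O p) := by
    by_contra! h
    have : ∀ᶠ n in atTop, ∀ p ∈ t, ¬ Disjoint (frontier (A n)) (O p) :=
      (Filter.eventually_all_finset t).2 h
    obtain ⟨n, hn⟩ := this.exists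
    obtain ⟨p, hp, hd⟩ := hex n
    exact hn p hp hd
  obtain ⟨φ, hφ, hφdisj⟩ := extraction_of_frequently_atTop hfreq
  obtain ⟨V, hV, hpV, hVO⟩ : ∃ V, IsOpen V ∧ p ∈ V ∧ closure V ⊆ O p := by
    obtain ⟨V, hV, h1, h2⟩ := normal_exists_closure_subset isClosed_singleton (hO p).2
      (singleton_subset_iff.2 (hO p).1)
    exact ⟨V, hV, singleton_subset_iff.1 h1, h2⟩
  obtain ⟨P, hP, hpP, hPV, hPfin⟩ := hreg p V hV hpV
  refine notMem_frontier_iUnion_of_disjoint (hmono.comp hφ.monotone) (fun n => hopen (φ n))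
    hφdisj hP hpP ((closure_mono hPV).trans hVO) hPfin ?_
  have hU : ⋃ n, (A ∘ φ) n = ⋃ n, A n := hmono.iUnion_comp_tendsto_atTop hφ.tendsto_atTop
  rw [hU]
  exact htsub hp

/-- Compact sets in a regular space have arbitrarily small neighborhoods with finite frontier. -/
theorem IsCompact.exists_isOpen_finite_frontier (hreg : regularCurveAx X) {K V : Set X}
    (hK : IsCompact K) (hV : IsOpen V) (hKV : K ⊆ V) :
    ∃ U, IsOpen U ∧ K ⊆ U ∧ U ⊆ V ∧ (frontier U).Finite := by
  refine hK.induction_on (p := fun s => ∃ U, IsOpen U ∧ s ⊆ U ∧ U ⊆ V ∧ (frontier U).Finite)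
    ⟨∅, isOpen_empty, Subset.rfl, empty_subset _, by simp⟩ ?_ ?_ ?_
  · rintro s t hst ⟨U, hU, htU, h⟩
    exact ⟨U, hU, hst.trans htU, h⟩
  · rintro s t ⟨U, hU, hsU, hUV, hUf⟩ ⟨W, hW, htW, hWV, hWf⟩
    exact ⟨U ∪ W, hU.union hW, union_subset_union hsU htW, union_subset hUV hWV,
      (hUf.union hWf).subset
        (subset_union_right.trans (frontier_inter_union_frontier_union_subset U W))⟩
  · intro x hx
    obtain ⟨U, hU, hxU, hUV, hUf⟩ := hreg x V hV (hKV hx)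
    exact ⟨U, mem_nhdsWithin_of_mem_nhds (hU.mem_nhds hxU), U, hU, Subset.rfl, hUV, hUf⟩

/-- Disjoint closed invariant sets of a homeomorphism of a regular curve are separated by a
nonempty finite invariant set, namely the frontier of the union of a family of minimal cuts. -/
theorem exists_finite_invariant_of_disjoint [CompactSpace X] [ConnectedSpace X]
    (hreg : regularCurveAx X) (f : X ≃ₜ X) {M N : Set X} (hM : IsClosed M) (hN : IsClosed N)
    (hMne : M.Nonempty) (hNne : N.Nonempty) (hfM : f '' M = M) (hfN : f '' N = N)
    (hMN : Disjoint M N) : ∃ F : Set X, F.Finite ∧ F.Nonempty ∧ f '' F = F := by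
  have hfM' : f ⁻¹' M = M := by conv_lhs => rw [← hfM, f.preimage_image]
  have hfN' : f ⁻¹' N = N := by conv_lhs => rw [← hfN, f.preimage_image]
  let cut : Set (Set X) := {U | IsOpen U ∧ M ⊆ U ∧ Disjoint (closure U) N}
  have hcut_ex : ∃ U ∈ cut, (frontier U).Finite := by
    obtain ⟨V, hV, hMV, hVN⟩ := normal_exists_closure_subset hM hN.isOpen_compl
      hMN.subset_compl_right
    obtain ⟨U, hU, hMU, hUV, hUf⟩ := hM.isCompact.exists_isOpen_finite_frontier hreg hV hMV
    exact ⟨U, ⟨hU, hMU, disjoint_left.2 fun x hx => hVN (closure_mono hUV hx)⟩, hUf⟩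
  obtain ⟨U, hU, hUmin⟩ : ∃ U ∈ cut, ∀ V ∈ cut, (frontier U).encard ≤ (frontier V).encard := by
    obtain ⟨U, hU, -⟩ := hcut_ex
    obtain ⟨k, ⟨V, hV, rfl⟩, hk⟩ := WellFounded.has_min (wellFounded_lt (α := ℕ∞))
      ((fun V => (frontier V).encard) '' cut) ⟨_, U, hU, rfl⟩
    exact ⟨V, hV, fun W hW => not_lt.1 (hk _ ⟨W, hW, rfl⟩)⟩
  have hUfin : (frontier U).Finite := by
    obtain ⟨V, hV, hVf⟩ := hcut_ex
    exact encard_lt_top_iff.1 ((hUmin V hV).trans_lt hVf.encard_lt_top)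
  let mincut : Set (Set X) := {V | V ∈ cut ∧ (frontier V).encard ≤ (frontier U).encard}
  have hunion : ∀ V ∈ mincut, ∀ W ∈ mincut, V ∪ W ∈ mincut := by
    rintro V ⟨⟨hV, hMV, hVN⟩, hVc⟩ W ⟨⟨hW, hMW, hWN⟩, hWc⟩
    refine ⟨⟨hV.union hW, hMV.trans subset_union_left, ?_⟩, ?_⟩
    · rw [closure_union]
      exact hVN.union_left hWN
    · have hinter : (frontier U).encard ≤ (frontier (V ∩ W)).encard :=
        hUmin _ ⟨hV.inter hW, subset_inter hMV hMW,
          hVN.mono_left (closure_mono inter_subset_left)⟩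
      have h := (add_le_add_left hinter _).trans ((encard_frontier_inter_add_union_le hV hW).trans
        (add_le_add hVc hWc))
      exact (ENat.add_le_add_iff_left hUfin.encard_lt_top.ne).1 h
  have himage : ∀ V ∈ mincut, f '' V ∈ mincut := by
    rintro V ⟨⟨hV, hMV, hVN⟩, hVc⟩
    refine ⟨⟨f.isOpen_image.2 hV, hfM ▸ image_mono hMV, ?_⟩, ?_⟩
    · rw [← f.image_closure, ← hfN, disjoint_image_iff f.injective]
      exact hVN
    · rwa [← f.image_frontier, f.injective.encard_image]
  have hpreimage : ∀ V ∈ mincut, f ⁻¹' V ∈ mincut := by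
    rintro V ⟨⟨hV, hMV, hVN⟩, hVc⟩
    refine ⟨⟨hV.preimage f.continuous, hfM' ▸ preimage_mono hMV, ?_⟩, ?_⟩
    · rw [← f.preimage_closure, ← hfN']
      exact hVN.preimage f
    · rwa [← f.preimage_frontier, ← f.image_symm, f.symm.injective.encard_image]
  let A : ℕ → Set X := fun n => (fun V => V ∪ (f '' V ∪ f ⁻¹' V))^[n] U
  have hA : ∀ n, A (n + 1) = A n ∪ (f '' A n ∪ f ⁻¹' A n) := fun n =>
    Function.iterate_succ_apply' _ _ _
  have hAmin : ∀ n, A n ∈ mincut := by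
    intro n
    induction n with
    | zero => exact ⟨hU, le_rfl⟩
    | succ n ih =>
      rw [hA]
      exact hunion _ ih _ (hunion _ (himage _ ih) _ (hpreimage _ ih))
  have hmono : Monotone A := monotone_nat_of_le_succ fun n => by
    rw [hA]
    exact subset_union_left
  have hopen : ∀ n, IsOpen (A n) := fun n => (hAmin n).1.1
  have hinv : f '' (⋃ n, A n) = ⋃ n, A n := by
    refine Subset.antisymm ?_ fun x hx => ?_
    · rw [image_iUnion]
      refine iUnion_mono' fun n => ⟨n + 1, ?_⟩
      rw [hA]
      exact subset_union_left.trans subset_union_right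
    · obtain ⟨n, hn⟩ := mem_iUnion.1 hx
      refine ⟨f.symm x, mem_iUnion.2 ⟨n + 1, ?_⟩, f.apply_symm_apply x⟩
      rw [hA]
      refine Or.inr (Or.inr ?_)
      rwa [mem_preimage, f.apply_symm_apply]
  refine ⟨frontier (⋃ n, A n), ?_, ?_, ?_⟩
  · obtain ⟨k, hk⟩ := ENat.ne_top_iff_exists.1 hUfin.encard_lt_top.ne
    exact finite_frontier_iUnion hreg hmono hopen fun n => (hAmin n).2.trans hk.symm.le
  · refine nonempty_frontier_iff.2 ⟨hMne.mono ((hAmin 0).1.2.1.trans (subset_iUnion A 0)), ?_⟩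
    obtain ⟨y, hy⟩ := hNne
    intro h
    obtain ⟨n, hn⟩ := mem_iUnion.1 (h ▸ mem_univ y)
    exact disjoint_left.1 (hAmin n).1.2.2 (subset_closure hn) hy
  · rw [f.image_frontier, hinv]

/-- A nonempty finite invariant set of an injective map contains a periodic point. -/
theorem Function.Injective.exists_iterate_eq_of_finite_invariant {α : Type*} {f : α → α}
    (hf : Function.Injective f) {F : Set α} (hfin : F.Finite) (hne : F.Nonempty)
    (hF : MapsTo f F F) : ∃ x ∈ F, ∃ n, 1 ≤ n ∧ f^[n] x = x := by
  obtain ⟨x, hx⟩ := hne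
  obtain ⟨m, n, hmn, h⟩ := hfin.exists_lt_map_eq_of_forall_mem
    (f := fun n : ℕ => f^[n] x) fun n => hF.iterate n hx
  exact ⟨x, hx, n - m, by omega, Function.iterate_cancel hf h.symm⟩

/-- Every homeomorphism of a nonempty compact space has a minimal set. -/
theorem exists_isMinimalSet [Nonempty X] [CompactSpace X] (f : X ≃ₜ X) :
    ∃ M, IsMinimalSet f M := by
  let S : Set (Set X) := {N | N.Nonempty ∧ IsClosed N ∧ f '' N = N}
  obtain ⟨M, -, hM⟩ := zorn_superset_nonempty S (fun c hcS hc hcne => by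
    refine ⟨⋂₀ c, ⟨?_, isClosed_sInter fun s hs => (hcS hs).2.1, ?_⟩,
      fun s hs => sInter_subset_of_mem hs⟩
    · exact IsCompact.nonempty_sInter_of_directed_nonempty_isCompact_isClosed
        (hS := hcne.to_subtype) (fun a ha b hb => (hc.total ha hb).elim
          (fun h => ⟨a, ha, Subset.rfl, h⟩) fun h => ⟨b, hb, h, Subset.rfl⟩)
        (fun s hs => (hcS hs).1)
        (fun s hs => (hcS hs).2.1.isCompact) fun s hs => (hcS hs).2.1
    · rw [sInter_eq_biInter, image_iInter₂ f.bijective]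
      exact iInter₂_congr fun s hs => (hcS hs).2.2) univ
    ⟨univ_nonempty, isClosed_univ, by rw [image_univ, f.surjective.range_eq]⟩
  exact ⟨M, hM.prop.1, hM.prop.2.1, hM.prop.2.2, fun N hNM hN hNc hfN =>
    hNM.antisymm (hM.le_of_le ⟨hN, hNc, hfN⟩ hNM)⟩

end RegularCurve

/-- A homeomorphism of a regular curve without periodic points has exactly one
minimal set. -/
theorem existsUnique_minimalSet_of_no_periodic {X : Type*} [MetricSpace X] [Nonempty X]
    [CompactSpace X] [ConnectedSpace X] (hreg : regularCurveAx X) (f : X ≃ₜ X)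
    (hnoper : ∀ (x : X) (n : ℕ), 1 ≤ n → (⇑f)^[n] x ≠ x) :
    ∃! M : Set X, IsMinimalSet (⇑f) M := by
  obtain ⟨M, hM⟩ := exists_isMinimalSet f
  refine ⟨M, hM, fun N hN => ?_⟩
  obtain ⟨hMne, hMc, hfM, hMmin⟩ := hM
  obtain ⟨hNne, hNc, hfN, hNmin⟩ := hN
  rcases (N ∩ M).eq_empty_or_nonempty with h | h
  · obtain ⟨F, hFfin, hFne, hF⟩ := exists_finite_invariant_of_disjoint hreg f hNc hMc hNne hMne
      hfN hfM (disjoint_iff_inter_eq_empty.2 h)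
    obtain ⟨x, -, n, hn, hx⟩ :=
      f.injective.exists_iterate_eq_of_finite_invariant hFfin hFne (mapsTo_iff_image_subset.2 hF.le)
    exact absurd hx (hnoper x n hn)
  · have hinv : f '' (N ∩ M) = N ∩ M := by rw [image_inter f.injective, hfN, hfM]
    exact (hNmin _ inter_subset_left h (hNc.inter hMc) hinv).symm.trans
      (hMmin _ inter_subset_right h (hNc.inter hMc) hinv)
end

section
/- Let X be a regular curve and f : X → X a homeomorphism having at least two distinct minimal sets. Then f has a periodic point. -/
open Set Filter Metric Topology

/-- Distinct minimal sets of a homeomorphism are disjoint. -/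
theorem IsMinimalSet.disjoint {X : Type*} [MetricSpace X] {f : X ≃ₜ X} {M N : Set X}
    (hM : IsMinimalSet f M) (hN : IsMinimalSet f N) (hne : M ≠ N) : Disjoint M N := by
  obtain ⟨-, hMc, hMf, hMmin⟩ := hM
  obtain ⟨-, hNc, hNf, hNmin⟩ := hN
  rw [Set.disjoint_iff_inter_eq_empty]
  by_contra h
  have hinter : f '' (M ∩ N) = M ∩ N := by rw [image_inter f.injective, hMf, hNf]
  have h' := nonempty_iff_ne_empty.mpr h
  exact hne ((hMmin _ inter_subset_left h' (hMc.inter hNc) hinter).symm.trans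
    (hNmin _ inter_subset_right h' (hMc.inter hNc) hinter))

/-- An injective map with a nonempty finite forward invariant set has a periodic point. -/
theorem exists_periodic_of_finite_mapsTo {X : Type*} {f : X → X} (hf : Function.Injective f)
    {F : Set X} (hF : F.Finite) (hne : F.Nonempty) (hmaps : MapsTo f F F) :
    ∃ (x : X) (n : ℕ), 1 ≤ n ∧ f^[n] x = x := by
  obtain ⟨x, hx⟩ := hne
  obtain ⟨m, n, hmn, heq⟩ := hF.exists_lt_map_eq_of_forall_mem (f := fun n : ℕ => f^[n] x)
    (fun n => hmaps.iterate n hx)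
  refine ⟨x, n - m, by omega, hf.iterate m ?_⟩
  rw [← Function.iterate_add_apply, Nat.add_sub_cancel' hmn.le]
  exact heq.symm

theorem frontier_union_union_frontier_inter_subset {X : Type*} [TopologicalSpace X]
    (U V : Set X) :
    frontier (U ∪ V) ∪ frontier (U ∩ V) ⊆ frontier U ∪ frontier V :=
  union_subset
    ((frontier_union_subset U V).trans (union_subset_union inter_subset_left inter_subset_right))
    ((frontier_inter_subset U V).trans (union_subset_union inter_subset_left inter_subset_right))

theorem frontier_union_inter_frontier_inter_subset {X : Type*} [TopologicalSpace X]
    {U V : Set X} (hU : IsOpen U) (hV : IsOpen V) :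
    frontier (U ∪ V) ∩ frontier (U ∩ V) ⊆ frontier U ∩ frontier V := by
  rw [(hU.union hV).frontier_eq, (hU.inter hV).frontier_eq, hU.frontier_eq, hV.frontier_eq]
  rintro x ⟨⟨-, hx⟩, hx', -⟩
  exact ⟨⟨closure_mono inter_subset_left hx', fun h => hx (Or.inl h)⟩,
    ⟨closure_mono inter_subset_right hx', fun h => hx (Or.inr h)⟩⟩

/-- The number of frontier points is submodular on open sets. -/
theorem ncard_frontier_union_add_ncard_frontier_inter_le {X : Type*} [TopologicalSpace X]
    {U V : Set X} (hU : IsOpen U) (hV : IsOpen V)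
    (hUf : (frontier U).Finite) (hVf : (frontier V).Finite) :
    (frontier (U ∪ V)).ncard + (frontier (U ∩ V)).ncard ≤
      (frontier U).ncard + (frontier V).ncard := by
  have hfin := hUf.union hVf
  have hsub := frontier_union_union_frontier_inter_subset U V
  rw [← ncard_union_add_ncard_inter _ _ (hfin.subset (subset_union_left.trans hsub))
      (hfin.subset (subset_union_right.trans hsub)), ← ncard_union_add_ncard_inter _ _ hUf hVf]
  exact add_le_add (ncard_le_ncard hsub hfin)
    (ncard_le_ncard (frontier_union_inter_frontier_inter_subset hU hV) (hUf.inter_of_left _))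

/-- If a directed family of open sets has `x` on the frontier of its union, then all sufficiently
large members of the family have frontier points close to `x`. -/
theorem exists_forall_frontier_inter_nonempty {X : Type*} [MetricSpace X] [ConnectedSpace X]
    (hreg : regularCurveAx X) {C : Set (Set X)} (hne : C.Nonempty) (hopen : ∀ U ∈ C, IsOpen U)
    (hunion : ∀ U ∈ C, ∀ V ∈ C, U ∪ V ∈ C) {x : X} (hx : x ∈ frontier (⋃₀ C))
    {V : Set X} (hV : IsOpen V) (hxV : x ∈ V) :
    ∃ U ∈ C, ∀ U' ∈ C, U ⊆ U' → (frontier U' ∩ V).Nonempty := by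
  by_contra! hcon
  rw [(isOpen_sUnion hopen).frontier_eq] at hx
  have hxC : ∀ U ∈ C, x ∉ U := fun U hU h => hx.2 ⟨U, hU, h⟩
  obtain ⟨Z, hZ, hZc, hZV⟩ := exists_mem_nhds_isClosed_subset (hV.mem_nhds hxV)
  obtain ⟨V', hV'o, hxV', hV'Z, hV'f⟩ := hreg x (interior Z) isOpen_interior
    (mem_interior_iff_mem_nhds.mpr hZ)
  have hclV : closure V' ⊆ V :=
    (closure_minimal (hV'Z.trans interior_subset) hZc).trans hZV
  -- a member without frontier points in `V`, with trace on `frontier V'` as large as possible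
  let D : Set (Set X) := {U ∈ C | frontier U ∩ V = ∅}
  have hD : D.Nonempty := by
    obtain ⟨U, hU⟩ := hne
    obtain ⟨U', hU', -, h⟩ := hcon U hU
    exact ⟨U', hU', h⟩
  have htr : ((fun U : Set X => U ∩ frontier V') '' D).Finite :=
    hV'f.finite_subsets.subset (by rintro _ ⟨U, -, rfl⟩; exact inter_subset_right)
  obtain ⟨_, ⟨⟨U, ⟨hUC, hUV⟩, rfl⟩, hmax⟩⟩ := htr.exists_maximal (hD.image _)
  have hclosed : ∀ A ∈ D, ∀ y ∈ closure A, y ∈ V → y ∈ A := by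
    intro A hA y hy hyV
    by_contra hyA
    have : y ∈ frontier A ∩ V := ⟨by rw [(hopen A hA.1).frontier_eq]; exact ⟨hy, hyA⟩, hyV⟩
    rw [hA.2] at this
    exact this
  have hUD : U ∈ D := ⟨hUC, hUV⟩
  have hxU : x ∉ closure U := fun h => hxC U hUC (hclosed U hUD x h hxV)
  obtain ⟨y, ⟨hyV', hyU⟩, A, hA, hyA⟩ := mem_closure_iff.mp hx.1 (V' ∩ (closure U)ᶜ)
    (hV'o.inter isClosed_closure.isOpen_compl) ⟨hxV', hxU⟩
  obtain ⟨B, hBC, hUAB, hBV⟩ := hcon (U ∪ A) (hunion U hUC A hA)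
  have hBD : B ∈ D := ⟨hBC, hBV⟩
  have htrace : B ∩ frontier V' ⊆ U ∩ frontier V' :=
    hmax ⟨B, hBD, rfl⟩ (inter_subset_inter_left _ (subset_union_left.trans hUAB))
  have hclopen : IsClopen ((B ∩ V') ∩ (closure U)ᶜ) := by
    refine ⟨isClosed_of_closure_subset fun z hz => ?_,
      ((hopen B hBC).inter hV'o).inter isClosed_closure.isOpen_compl⟩
    have hzV' : z ∈ closure V' := closure_mono (fun w hw => hw.1.2) hz
    have hzB : z ∈ B := hclosed B hBD z (closure_mono (fun w hw => hw.1.1) hz) (hclV hzV')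
    have hzU : z ∉ U := by
      intro h
      obtain ⟨w, hwU, hw⟩ := mem_closure_iff.mp hz U (hopen U hUC) h
      exact hw.2 (subset_closure hwU)
    refine ⟨⟨hzB, ?_⟩, fun h => hzU (hclosed U hUD z h (hclV hzV'))⟩
    by_contra h
    exact hzU (htrace ⟨hzB, by rw [hV'o.frontier_eq]; exact ⟨hzV', h⟩⟩).1
  have huniv := hclopen.eq_univ ⟨y, ⟨hUAB (Or.inr hyA), hyV'⟩, hyU⟩
  have hxB : x ∈ (B ∩ V') ∩ (closure U)ᶜ := huniv ▸ mem_univ x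
  exact hxC B hBC hxB.1.1

/-- A union-closed family of open sets with uniformly finite frontiers has a union with
finite frontier. -/
theorem finite_frontier_sUnion {X : Type*} [MetricSpace X] [ConnectedSpace X]
    (hreg : regularCurveAx X) {C : Set (Set X)} (hne : C.Nonempty) (hopen : ∀ U ∈ C, IsOpen U)
    (hunion : ∀ U ∈ C, ∀ V ∈ C, U ∪ V ∈ C) {k : ℕ}
    (hfin : ∀ U ∈ C, (frontier U).Finite) (hk : ∀ U ∈ C, (frontier U).ncard ≤ k) :
    (frontier (⋃₀ C)).Finite := by
  by_contra hinf
  obtain ⟨T, hT, hTk⟩ := Set.Infinite.exists_subset_card_eq hinf (k + 1)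
  obtain ⟨V, hV, hVd⟩ := T.finite_toSet.t2_separation
  have hlarge : ∀ S : Finset X, S ⊆ T → ∃ U ∈ C, ∀ x ∈ S, ∀ U' ∈ C, U ⊆ U' →
      (frontier U' ∩ V x).Nonempty := by
    classical
    intro S
    induction S using Finset.induction_on with
    | empty => exact fun _ => ⟨hne.some, hne.some_mem, by simp⟩
    | insert a S _ ih =>
      intro hS
      obtain ⟨haT, hST⟩ := Finset.insert_subset_iff.mp hS
      obtain ⟨U, hU, hUS⟩ := ih hST
      obtain ⟨A, hA, hAa⟩ := exists_forall_frontier_inter_nonempty hreg hne hopen hunion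
        (hT haT) (hV a).2 (hV a).1
      refine ⟨U ∪ A, hunion U hU A hA, fun x hx U' hU' hsub => ?_⟩
      rcases Finset.mem_insert.mp hx with rfl | hx
      · exact hAa U' hU' (subset_union_right.trans hsub)
      · exact hUS x hx U' hU' (subset_union_left.trans hsub)
  obtain ⟨U, hU, hUT⟩ := hlarge T subset_rfl
  choose! p hp using fun x hx => hUT x hx U hU subset_rfl
  have hinj : Set.InjOn p T := by
    intro x hx y hy hxy
    by_contra hxy'
    exact disjoint_left.mp (hVd hx hy hxy') (hp x hx).2 (hxy ▸ (hp y hy).2)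
  have hle := ncard_le_ncard_of_injOn (s := (T : Set X)) p (fun x hx => (hp x hx).1) hinj
    (hfin U hU)
  rw [ncard_coe_finset, hTk] at hle
  exact absurd (hk U hU) (by omega)

/-- Disjoint compact and closed sets are separated by an open set with finite frontier. -/
theorem exists_isOpen_finite_frontier {X : Type*} [MetricSpace X] (hreg : regularCurveAx X)
    {M N : Set X} (hM : IsCompact M) (hN : IsClosed N) (hdisj : Disjoint M N) :
    ∃ U : Set X, IsOpen U ∧ M ⊆ U ∧ Disjoint U N ∧ (frontier U).Finite := by
  refine hM.induction_on (p := fun S => ∃ U : Set X, IsOpen U ∧ S ⊆ U ∧ Disjoint U N ∧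
    (frontier U).Finite) ⟨∅, by simp⟩ ?_ ?_ ?_
  · rintro S T hST ⟨U, hU, hTU, h⟩
    exact ⟨U, hU, hST.trans hTU, h⟩
  · rintro S T ⟨U, hU, hSU, hUN, hUf⟩ ⟨V, hV, hTV, hVN, hVf⟩
    exact ⟨U ∪ V, hU.union hV, union_subset_union hSU hTV, hUN.union_left hVN,
      (hUf.union hVf).subset
        (subset_union_left.trans (frontier_union_union_frontier_inter_subset U V))⟩
  · intro x hx
    obtain ⟨U, hU, hxU, hUN, hUf⟩ := hreg x Nᶜ hN.isOpen_compl (disjoint_left.mp hdisj hx)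
    exact ⟨U, mem_nhdsWithin_of_mem_nhds (hU.mem_nhds hxU), U, hU, subset_rfl,
      disjoint_left.mpr hUN, hUf⟩

/-- A homeomorphism of a regular curve with at least two distinct minimal sets has
a periodic point. -/
theorem exists_periodic_of_two_minimalSets {X : Type*} [MetricSpace X] [Nonempty X]
    [CompactSpace X] [ConnectedSpace X] (hreg : regularCurveAx X) (f : X ≃ₜ X)
    (htwo : ∃ M N : Set X, IsMinimalSet (⇑f) M ∧ IsMinimalSet (⇑f) N ∧ M ≠ N) :
    ∃ (x : X) (n : ℕ), 1 ≤ n ∧ (⇑f)^[n] x = x := by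
  obtain ⟨M, N, hM, hN, hne⟩ := htwo
  have hdisj := hM.disjoint hN hne
  obtain ⟨⟨a, ha⟩, hMc, hMf, -⟩ := hM
  obtain ⟨⟨b, hb⟩, hNc, hNf, -⟩ := hN
  let A : Set (Set X) := {U | IsOpen U ∧ M ⊆ U ∧ Disjoint U N ∧ (frontier U).Finite}
  have hA : A.Nonempty := exists_isOpen_finite_frontier hreg hMc.isCompact hNc hdisj
  obtain ⟨U₀, hU₀, hmin⟩ := exists_minimalFor_of_wellFoundedLT (· ∈ A)
    (fun U => (frontier U).ncard) hA
  let C : Set (Set X) := {U ∈ A | (frontier U).ncard ≤ (frontier U₀).ncard}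
  have hCne : C.Nonempty := ⟨U₀, hU₀, le_rfl⟩
  have hopen : ∀ U ∈ C, IsOpen U := fun U hU => hU.1.1
  have hunion : ∀ U ∈ C, ∀ V ∈ C, U ∪ V ∈ C := by
    rintro U ⟨⟨hU, hMU, hUN, hUf⟩, hUk⟩ V ⟨⟨hV, hMV, hVN, hVf⟩, hVk⟩
    have hsub := frontier_union_union_frontier_inter_subset U V
    have hinter : U ∩ V ∈ A := ⟨hU.inter hV, subset_inter hMU hMV,
      hUN.mono_left inter_subset_left,
      (hUf.union hVf).subset (subset_union_right.trans hsub)⟩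
    have hge : (frontier U₀).ncard ≤ (frontier (U ∩ V)).ncard :=
      (le_total _ _).elim id (hmin hinter)
    have hle := ncard_frontier_union_add_ncard_frontier_inter_le hU hV hUf hVf
    exact ⟨⟨hU.union hV, hMU.trans subset_union_left, hUN.union_left hVN,
      (hUf.union hVf).subset (subset_union_left.trans hsub)⟩, by omega⟩
  have himage : ∀ g : X ≃ₜ X, g '' M = M → g '' N = N → ∀ U ∈ C, g '' U ∈ C := by
    rintro g hgM hgN U ⟨⟨hU, hMU, hUN, hUf⟩, hUk⟩
    refine ⟨⟨g.isOpenMap U hU, hgM ▸ image_mono hMU, ?_, ?_⟩, ?_⟩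
    · rw [← hgN]
      exact (disjoint_image_iff g.injective).mpr hUN
    · rw [← g.image_frontier]
      exact hUf.image g
    · rw [← g.image_frontier, ncard_image_of_injective _ g.injective]
      exact hUk
  have hmaps : ∀ g : X ≃ₜ X, g '' M = M → g '' N = N → g '' ⋃₀ C ⊆ ⋃₀ C := by
    rintro g hgM hgN _ ⟨x, ⟨U, hU, hxU⟩, rfl⟩
    exact ⟨g '' U, himage g hgM hgN U hU, mem_image_of_mem g hxU⟩
  have hsymm : ∀ S : Set X, f '' S = S → f.symm '' S = S := by
    intro S hS
    conv_lhs => rw [← hS]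
    rw [← image_comp, f.symm_comp_self, image_id]
  have hinv : f '' ⋃₀ C = ⋃₀ C := by
    refine (hmaps f hMf hNf).antisymm fun x hx => ⟨f.symm x, ?_, f.apply_symm_apply x⟩
    exact hmaps f.symm (hsymm M hMf) (hsymm N hNf) (mem_image_of_mem _ hx)
  refine exists_periodic_of_finite_mapsTo f.injective
    (finite_frontier_sUnion hreg hCne hopen hunion (fun U hU => hU.1.2.2.2) (fun U hU => hU.2))
    (F := frontier (⋃₀ C)) ?_ ?_
  · rw [nonempty_frontier_iff]
    refine ⟨⟨a, U₀, ⟨hU₀, le_rfl⟩, hU₀.2.1 ha⟩, fun h => ?_⟩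
    obtain ⟨U, hU, hbU⟩ : b ∈ ⋃₀ C := h ▸ mem_univ b
    exact disjoint_left.mp hU.1.2.2.1 hbU hb
  · rw [mapsTo_iff_image_subset, f.image_frontier, hinv]
end

section
/- Let X be a regular curve and f : X → X a homeomorphism with no periodic points, and let M be its unique minimal set. Then the restriction of f to M is totally minimal: for every integer n ≥ 1, M is a minimal set of f^n. -/
open Set Filter Metric Topology

section FiniteFrontier

variable {X : Type*} [TopologicalSpace X]

/-- In a compact connected Hausdorff space, the closure of an open set with finite frontier has
only finitely many components, so the component of an interior point is a neighborhood. -/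
theorem IsOpen.exists_preconnected_nhd_of_finite_frontier [T2Space X] [CompactSpace X]
    [PreconnectedSpace X] {U : Set X} (hU : IsOpen U) (hfin : (frontier U).Finite)
    {x : X} (hx : x ∈ U) :
    ∃ C ∈ 𝓝 x, C ⊆ closure U ∧ IsPreconnected C := by
  have hemb : IsClosedEmbedding ((↑) : closure U → X) := isClosed_closure.isClosedEmbedding_subtypeVal
  have : CompactSpace (closure U) := isCompact_iff_compactSpace.mp isClosed_closure.isCompact
  let x' : closure U := ⟨x, subset_closure hx⟩
  have bump : ∀ W : Set (closure U), IsClopen W → x' ∉ W →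
      (∀ y ∈ W, (y : X) ∉ frontier U) → W = ∅ := by
    intro W hW hxW hWF
    obtain ⟨O, hO, rfl⟩ := isOpen_induced_iff.mp hW.isOpen
    have himage : ((↑) : closure U → X) '' ((↑) ⁻¹' O) = O ∩ U := by
      ext y
      constructor
      · rintro ⟨⟨z, hz⟩, hzO, rfl⟩
        refine ⟨hzO, ?_⟩
        by_contra hzU
        exact hWF ⟨z, hz⟩ hzO (by rw [hU.frontier_eq]; exact ⟨hz, hzU⟩)
      · rintro ⟨hyO, hyU⟩
        exact ⟨⟨y, subset_closure hyU⟩, hyO, rfl⟩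
    have hclopen : IsClopen (O ∩ U) :=
      ⟨himage ▸ hemb.isClosedMap _ hW.isClosed, hO.inter hU⟩
    rcases isClopen_iff.mp hclopen with h | h
    · rw [h] at himage
      exact image_eq_empty.mp himage
    · exact absurd (h.symm ▸ mem_univ x : x ∈ O ∩ U).1 hxW
  let F : Set (closure U) := ((↑) ⁻¹' frontier U) \ connectedComponent x'
  have hF : F.Finite := (hfin.preimage Subtype.val_injective.injOn).subset sdiff_subset
  have hcompl : (connectedComponent x')ᶜ = ⋃ p ∈ F, connectedComponent p := by
    ext y
    simp only [mem_compl_iff, mem_iUnion, exists_prop]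
    constructor
    · intro hy
      by_contra! hno
      have hsep : ∀ p : closure U, (p : X) ∈ frontier U →
          ∃ K : Set (closure U), IsClopen K ∧ y ∈ K ∧ p ∉ K := by
        intro p hp
        have hpy : p ∉ connectedComponent y := by
          intro hpy
          have heq := connectedComponent_eq hpy
          refine hno p ⟨hp, fun hpx => hy ?_⟩ (heq ▸ mem_connectedComponent)
          rw [connectedComponent_eq hpx, ← heq]
          exact mem_connectedComponent
        rw [connectedComponent_eq_iInter_isClopen] at hpy
        simp only [mem_iInter, not_forall] at hpy
        obtain ⟨⟨K, hK, hyK⟩, hpK⟩ := hpy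
        exact ⟨K, hK, hyK, hpK⟩
      have hxy : x' ∉ connectedComponent y := by
        intro h
        exact hy (connectedComponent_eq h ▸ mem_connectedComponent)
      rw [connectedComponent_eq_iInter_isClopen] at hxy
      simp only [mem_iInter, not_forall] at hxy
      obtain ⟨⟨Z, hZ, hyZ⟩, hxZ⟩ := hxy
      choose! K hK hyK hpK using hsep
      have hP : (((↑) : closure U → X) ⁻¹' frontier U).Finite :=
        hfin.preimage Subtype.val_injective.injOn
      have hempty := bump (Z ∩ ⋂ p ∈ ((↑) : closure U → X) ⁻¹' frontier U, K p)
        (hZ.inter (hP.isClopen_biInter fun p hp => hK p hp)) (fun h => hxZ h.1)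
        (fun q hq hqF => hpK q hqF (mem_iInter₂.mp hq.2 q hqF))
      exact (hempty ▸ ⟨hyZ, mem_iInter₂.mpr hyK⟩ : y ∈ (∅ : Set (closure U)))
    · rintro ⟨p, hp, hyp⟩ hyx
      apply hp.2
      rw [connectedComponent_eq hyx, ← connectedComponent_eq hyp]
      exact mem_connectedComponent
  have hopen : IsOpen (connectedComponent x') := by
    rw [← isClosed_compl_iff, hcompl]
    exact hF.isClosed_biUnion fun p _ => isClosed_connectedComponent
  refine ⟨(↑) '' connectedComponent x', ?_, ?_,
    isPreconnected_connectedComponent.image _ continuous_subtype_val.continuousOn⟩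
  · obtain ⟨O, hO, hOC⟩ := isOpen_induced_iff.mp hopen
    have hxO : x' ∈ ((↑) : closure U → X) ⁻¹' O := hOC ▸ mem_connectedComponent
    filter_upwards [(hO.inter hU).mem_nhds ⟨hxO, hx⟩] with y hy
    exact ⟨⟨y, subset_closure hy.2⟩, hOC ▸ hy.1, rfl⟩
  · rintro _ ⟨y, -, rfl⟩
    exact y.2

theorem IsPreconnected.inter_frontier_nonempty {C D : Set X} (hC : IsPreconnected C)
    (hmeet : (C ∩ D).Nonempty) (hmiss : (C ∩ Dᶜ).Nonempty) : (C ∩ frontier D).Nonempty := by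
  by_contra hemp
  have hfr : ∀ z ∈ C, z ∉ frontier D := fun z hz hzD => hemp ⟨z, hz, hzD⟩
  obtain ⟨a, haC, haD⟩ := hmeet
  obtain ⟨b, hbC, hbD⟩ := hmiss
  have hin : ∀ z ∈ C, z ∈ closure D → z ∈ interior D := fun z hz hzD => by
    by_contra h
    exact hfr z hz ⟨hzD, h⟩
  obtain ⟨z, -, hzi, hzc⟩ := hC (interior D) (closure D)ᶜ isOpen_interior
    isClosed_closure.isOpen_compl
    (fun z hz => (em (z ∈ closure D)).imp (hin z hz) id)
    ⟨a, haC, hin a haC (subset_closure haD)⟩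
    ⟨b, hbC, fun h => hbD (interior_subset (hin b hbC h))⟩
  exact hzc (interior_subset_closure hzi)

/-- The number of frontier points is submodular. -/
theorem ncard_frontier_inter_add_ncard_frontier_union_le {A B : Set X}
    (hA : (frontier A).Finite) (hB : (frontier B).Finite) :
    (frontier (A ∩ B)).ncard + (frontier (A ∪ B)).ncard ≤
      (frontier A).ncard + (frontier B).ncard := by
  have hi : frontier (A ∩ B) ⊆ frontier A ∪ frontier B :=
    (frontier_inter_subset A B).trans (union_subset_union inter_subset_left inter_subset_right)
  have hu : frontier (A ∪ B) ⊆ frontier A ∪ frontier B :=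
    (frontier_union_subset A B).trans (union_subset_union inter_subset_left inter_subset_right)
  have hAB := hA.union hB
  rw [← ncard_union_add_ncard_inter _ _ (hAB.subset hi) (hAB.subset hu),
    ← ncard_union_add_ncard_inter _ _ hA hB]
  refine add_le_add (ncard_le_ncard (union_subset hi hu) hAB)
    (ncard_le_ncard ?_ (hA.subset inter_subset_left))
  rintro x ⟨hxi, hxu⟩
  rw [frontier_eq_closure_inter_closure] at hxi hxu
  simp only [frontier_eq_closure_inter_closure]
  exact ⟨⟨closure_mono inter_subset_left hxi.1,
      closure_mono (compl_subset_compl.mpr subset_union_left) hxu.2⟩,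
    closure_mono inter_subset_right hxi.1,
      closure_mono (compl_subset_compl.mpr subset_union_right) hxu.2⟩

/-- If a family of sets whose frontiers have at most `k` points is closed under binary
intersections, then the intersection of the family has finite frontier. -/
theorem finite_frontier_sInter [T2Space X]
    (hlc : ∀ (x : X) (V : Set X), IsOpen V → x ∈ V → ∃ C ∈ 𝓝 x, C ⊆ V ∧ IsPreconnected C)
    {𝒜 : Set (Set X)} (hne : 𝒜.Nonempty) (hinter : ∀ A ∈ 𝒜, ∀ B ∈ 𝒜, A ∩ B ∈ 𝒜) {k : ℕ}
    (hfin : ∀ A ∈ 𝒜, (frontier A).Finite) (hk : ∀ A ∈ 𝒜, (frontier A).ncard ≤ k) :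
    (frontier (⋂₀ 𝒜)).Finite := by
  classical
  by_contra hinf
  obtain ⟨T, hT, hTcard⟩ := Set.Infinite.exists_subset_card_eq hinf (k + 1)
  obtain ⟨V, hV, hVdisj⟩ := T.finite_toSet.t2_separation
  choose C hCx hCV hC using fun x => hlc x (V x) (hV x).2 (hV x).1
  have hmiss : ∀ x ∈ T, ∃ A ∈ 𝒜, ∃ y ∈ C x, y ∉ A := by
    intro x hx
    have := hT hx
    rw [frontier_eq_closure_inter_closure] at this
    obtain ⟨y, hyC, hyA⟩ := mem_closure_iff_nhds.mp this.2 _ (hCx x)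
    simp only [mem_compl_iff, mem_sInter, not_forall] at hyA
    obtain ⟨A, hA, hyA⟩ := hyA
    exact ⟨A, hA, y, hyC, hyA⟩
  choose! A hA y hyC hyA using hmiss
  have hcommon : ∀ S : Finset X, S ⊆ T → ∃ D ∈ 𝒜, ∀ x ∈ S, D ⊆ A x := by
    intro S
    induction S using Finset.induction_on with
    | empty => exact fun _ => ⟨hne.some, hne.some_mem, by simp⟩
    | insert a S _ ih =>
      intro hS
      obtain ⟨D, hD, hDA⟩ := ih ((Finset.subset_insert a S).trans hS)
      refine ⟨A a ∩ D, hinter _ (hA a (hS (Finset.mem_insert_self a S))) _ hD, ?_⟩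
      intro x hx
      rcases Finset.mem_insert.mp hx with rfl | hx
      · exact inter_subset_left
      · exact inter_subset_right.trans (hDA x hx)
  obtain ⟨D, hD, hDA⟩ := hcommon T subset_rfl
  have hmeet : ∀ x ∈ T, (C x ∩ frontier D).Nonempty := by
    intro x hx
    have hcl := hT hx
    rw [frontier_eq_closure_inter_closure] at hcl
    obtain ⟨z, hzC, hz⟩ := mem_closure_iff_nhds.mp hcl.1 _ (hCx x)
    exact (hC x).inter_frontier_nonempty ⟨z, hzC, hz D hD⟩
      ⟨y x, hyC x hx, fun h => hyA x hx (hDA x hx h)⟩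
  choose! p hpC hpD using hmeet
  have hinj : InjOn p (T : Set X) := by
    intro a ha b hb hab
    by_contra hne
    exact disjoint_left.mp (hVdisj ha hb hne) (hCV a (hpC a ha)) (hab ▸ hCV b (hpC b hb))
  have hle : (T : Set X).ncard ≤ (frontier D).ncard :=
    ncard_le_ncard_of_injOn p (fun a ha => hpD a ha) hinj (hfin D hD)
  rw [ncard_coe_finset, hTcard] at hle
  exact absurd (hle.trans (hk D hD)) (by omega)

end FiniteFrontier

/-- A compact space satisfying the regular curve condition admits a set with finite frontier
separating any two disjoint closed sets. -/
theorem regularCurveAx.exists_separation {X : Type*} [MetricSpace X] [CompactSpace X]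
    (hreg : regularCurveAx X) {P Q : Set X} (hP : IsClosed P) (hQ : IsClosed Q)
    (hPQ : Disjoint P Q) : ∃ A : Set X, P ⊆ A ∧ Disjoint A Q ∧ (frontier A).Finite := by
  refine hP.isCompact.induction_on (p := fun S => ∃ A : Set X, S ⊆ A ∧ Disjoint A Q ∧
    (frontier A).Finite) ⟨∅, subset_rfl, by simp, by simp⟩ ?_ ?_ ?_
  · rintro S T hST ⟨A, hTA, hA⟩
    exact ⟨A, hST.trans hTA, hA⟩
  · rintro S T ⟨A, hSA, hAQ, hA⟩ ⟨B, hTB, hBQ, hB⟩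
    exact ⟨A ∪ B, union_subset_union hSA hTB, disjoint_union_left.mpr ⟨hAQ, hBQ⟩,
      (hA.union hB).subset ((frontier_union_subset A B).trans
        (union_subset_union inter_subset_left inter_subset_right))⟩
  · intro x hx
    obtain ⟨U, hU, hxU, hUQ, hfin⟩ := hreg x Qᶜ hQ.isOpen_compl (disjoint_left.mp hPQ hx)
    exact ⟨U, mem_nhdsWithin_of_mem_nhds (hU.mem_nhds hxU), U, subset_rfl,
      disjoint_left.mpr hUQ, hfin⟩

theorem regularCurveAx.exists_preconnected_nhd {X : Type*} [MetricSpace X] [CompactSpace X]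
    [PreconnectedSpace X] (hreg : regularCurveAx X) (x : X) (V : Set X) (hV : IsOpen V)
    (hx : x ∈ V) : ∃ C ∈ 𝓝 x, C ⊆ V ∧ IsPreconnected C := by
  obtain ⟨W, hWx, hW, hWV⟩ := exists_mem_nhds_isClosed_subset (hV.mem_nhds hx)
  obtain ⟨U, hU, hxU, hUW, hfin⟩ := hreg x (interior W) isOpen_interior
    (mem_interior_iff_mem_nhds.mpr hWx)
  obtain ⟨C, hCx, hCU, hC⟩ := hU.exists_preconnected_nhd_of_finite_frontier hfin hxU
  exact ⟨C, hCx, hCU.trans ((closure_minimal (hUW.trans interior_subset) hW).trans hWV), hC⟩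

/-- A nonempty finite set invariant under an injective map contains a periodic point. -/
theorem Set.Finite.exists_iterate_eq_self {α : Type*} {S : Set α} (hS : S.Finite)
    (hne : S.Nonempty) {g : α → α} (hg : Function.Injective g) (hmaps : MapsTo g S S) :
    ∃ (x : α) (n : ℕ), 1 ≤ n ∧ g^[n] x = x := by
  obtain ⟨x, hx⟩ := hne
  obtain ⟨a, b, hab, heq⟩ :=
    hS.exists_lt_map_eq_of_forall_mem (f := fun n : ℕ => g^[n] x) fun n => hmaps.iterate n hx
  refine ⟨x, b - a, by omega, hg.iterate a ?_⟩
  rw [← Function.iterate_add_apply, Nat.add_sub_cancel' hab.le]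
  exact heq.symm

/-- Two nonempty closed invariant sets of a periodic point free homeomorphism of a regular curve
intersect: otherwise the intersection of all separating sets with the least number of frontier
points has a finite, nonempty and invariant frontier. -/
theorem regularCurveAx.inter_nonempty_of_invariant {X : Type*} [MetricSpace X]
    [CompactSpace X] [PreconnectedSpace X] (hreg : regularCurveAx X) (g : X ≃ₜ X)
    (hnoper : ∀ (x : X) (n : ℕ), 1 ≤ n → (⇑g)^[n] x ≠ x) {P Q : Set X}
    (hP : IsClosed P) (hQ : IsClosed Q) (hPne : P.Nonempty) (hQne : Q.Nonempty)
    (hgP : g '' P = P) (hgQ : g '' Q = Q) : (P ∩ Q).Nonempty := by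
  by_contra hdisj
  rw [← not_disjoint_iff_nonempty_inter, not_not] at hdisj
  let ℬ : Set (Set X) := {A | P ⊆ A ∧ Disjoint A Q ∧ (frontier A).Finite}
  have hℬ : ℬ.Nonempty := hreg.exists_separation hP hQ hdisj
  obtain ⟨A₀, hA₀, hmin⟩ : ∃ A₀ ∈ ℬ, ∀ B ∈ ℬ, (frontier A₀).ncard ≤ (frontier B).ncard :=
    ⟨Function.argminOn (fun A => (frontier A).ncard) ℬ hℬ, Function.argminOn_mem _ _ _,
      fun B hB => Function.argminOn_le (fun A : Set X => (frontier A).ncard) ℬ hB⟩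
  let 𝒜 : Set (Set X) := {A | A ∈ ℬ ∧ (frontier A).ncard = (frontier A₀).ncard}
  have hinter : ∀ A ∈ 𝒜, ∀ B ∈ 𝒜, A ∩ B ∈ 𝒜 := by
    rintro A ⟨⟨hPA, hAQ, hAfin⟩, hAk⟩ B ⟨⟨hPB, hBQ, hBfin⟩, hBk⟩
    have hfin := hAfin.union hBfin
    have hi : A ∩ B ∈ ℬ := ⟨subset_inter hPA hPB, hAQ.mono_left inter_subset_left,
      hfin.subset ((frontier_inter_subset A B).trans
        (union_subset_union inter_subset_left inter_subset_right))⟩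
    have hu : A ∪ B ∈ ℬ := ⟨hPA.trans subset_union_left, disjoint_union_left.mpr ⟨hAQ, hBQ⟩,
      hfin.subset ((frontier_union_subset A B).trans
        (union_subset_union inter_subset_left inter_subset_right))⟩
    have hsub := ncard_frontier_inter_add_ncard_frontier_union_le hAfin hBfin
    have := hmin _ hi
    have := hmin _ hu
    exact ⟨hi, by omega⟩
  have hpre : ∀ h : X ≃ₜ X, h '' P = P → h '' Q = Q → ⋂₀ 𝒜 ⊆ h ⁻¹' ⋂₀ 𝒜 := by
    rintro h hhP hhQ x hx A ⟨⟨hPA, hAQ, hAfin⟩, hAk⟩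
    have hfr : frontier (h ⁻¹' A) = h.symm '' frontier A := by
      rw [h.image_symm, h.preimage_frontier]
    refine hx (h ⁻¹' A) ⟨⟨?_, ?_, ?_⟩, ?_⟩
    · rw [← image_subset_iff, hhP]
      exact hPA
    · rw [← disjoint_image_iff h.injective, image_preimage_eq _ h.surjective, hhQ]
      exact hAQ
    · rw [hfr]
      exact hAfin.image _
    · rw [hfr, ncard_image_of_injective _ h.symm.injective, hAk]
  have hsymm : ∀ S : Set X, g '' S = S → g.symm '' S = S := fun S hS => by
    conv_lhs => rw [← hS]
    exact g.toEquiv.symm_image_image S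
  have hinv : g ⁻¹' ⋂₀ 𝒜 = ⋂₀ 𝒜 := by
    refine (hpre g hgP hgQ).antisymm' fun x hx => ?_
    have := hpre g.symm (hsymm P hgP) (hsymm Q hgQ) hx
    rwa [mem_preimage, g.symm_apply_apply] at this
  have hmaps : MapsTo g (frontier (⋂₀ 𝒜)) (frontier (⋂₀ 𝒜)) := by
    intro x hx
    rwa [← mem_preimage, g.preimage_frontier, hinv]
  have hfin : (frontier (⋂₀ 𝒜)).Finite :=
    finite_frontier_sInter hreg.exists_preconnected_nhd ⟨A₀, hA₀, rfl⟩ hinter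
      (fun A hA => hA.1.2.2) (fun A hA => hA.2.le)
  have hne : (frontier (⋂₀ 𝒜)).Nonempty := by
    obtain ⟨p, hp⟩ := hPne
    obtain ⟨q, hq⟩ := hQne
    refine nonempty_frontier_iff.mpr ⟨⟨p, fun A hA => hA.1.1 hp⟩, fun h => ?_⟩
    exact disjoint_left.mp hA₀.2.1 ((h ▸ mem_univ q : q ∈ ⋂₀ 𝒜) A₀ ⟨hA₀, rfl⟩) hq
  obtain ⟨x, n, hn, hx⟩ := hfin.exists_iterate_eq_self hne g.injective hmaps
  exact hnoper x n hn hx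

/-- For a homeomorphism of a regular curve without periodic points, its unique
minimal set M is totally minimal: M is a minimal set of fⁿ for every n ≥ 1. -/
theorem uniqueMinimalSet_totallyMinimal {X : Type*} [MetricSpace X] [Nonempty X]
    [CompactSpace X] [ConnectedSpace X] (hreg : regularCurveAx X) (f : X ≃ₜ X)
    (hnoper : ∀ (x : X) (n : ℕ), 1 ≤ n → (⇑f)^[n] x ≠ x)
    (M : Set X) (hM : IsMinimalSet (⇑f) M)
    (huniq : ∀ N : Set X, IsMinimalSet (⇑f) N → N = M) :
    ∀ n : ℕ, 1 ≤ n → IsMinimalSet ((⇑f)^[n]) M := by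
  intro n hn
  obtain ⟨g, hg⟩ : ∃ g : X ≃ₜ X, ⇑g = (⇑f)^[n] := by
    clear hn
    induction n with
    | zero => exact ⟨Homeomorph.refl X, rfl⟩
    | succ n ih =>
      obtain ⟨g, hg⟩ := ih
      exact ⟨f.trans g, by rw [Function.iterate_succ, ← hg]; rfl⟩
  obtain ⟨hMne, hMcl, hfM, hMmin⟩ := hM
  have hgM : g '' M = M := by
    rw [hg, image_iterate_eq]
    exact Function.iterate_fixed hfM n
  rw [← hg]
  refine ⟨hMne, hMcl, hgM, fun N hNM hNne hNcl hgN => ?_⟩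
  have hgnoper : ∀ (x : X) (m : ℕ), 1 ≤ m → (⇑g)^[m] x ≠ x := fun x m hm => by
    rw [hg, ← Function.iterate_mul]
    exact hnoper x (n * m) (Nat.mul_pos hn hm)
  have hgf : Function.Commute g f := hg ▸ Function.Commute.iterate_self f n
  let 𝒩 : Set (Set X) := {S | S.Nonempty ∧ IsClosed S ∧ g '' S = S}
  have hM𝒩 : M ∈ 𝒩 := ⟨hMne, hMcl, hgM⟩
  have hinter : ∀ S ∈ 𝒩, ∀ T ∈ 𝒩, S ∩ T ∈ 𝒩 := by
    rintro S ⟨hSne, hScl, hgS⟩ T ⟨hTne, hTcl, hgT⟩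
    refine ⟨hreg.inter_nonempty_of_invariant g hgnoper hScl hTcl hSne hTne hgS hgT,
      hScl.inter hTcl, ?_⟩
    rw [image_inter g.injective, hgS, hgT]
  have hne : (⋂₀ 𝒩).Nonempty := by
    have : Nonempty 𝒩 := ⟨⟨M, hM𝒩⟩⟩
    refine IsCompact.nonempty_sInter_of_directed_nonempty_isCompact_isClosed
      ?_ (fun S hS => hS.1) (fun S hS => hS.2.1.isCompact) fun S hS => hS.2.1
    exact fun S hS T hT => ⟨S ∩ T, hinter S hS T hT, inter_subset_left, inter_subset_right⟩
  have himage : ∀ S ∈ 𝒩, f '' S ∈ 𝒩 := by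
    rintro S ⟨hSne, hScl, hgS⟩
    refine ⟨hSne.image f, f.isClosedMap S hScl, ?_⟩
    rw [← image_comp, hgf.comp_eq, image_comp, hgS]
  have hpreimage : ∀ S ∈ 𝒩, f ⁻¹' S ∈ 𝒩 := by
    rintro S ⟨hSne, hScl, hgS⟩
    refine ⟨hSne.preimage f.surjective, hScl.preimage f.continuous, ?_⟩
    apply f.injective.image_injective
    rw [← image_comp, ← hgf.comp_eq, image_comp, image_preimage_eq S f.surjective, hgS]
  have hfix : f '' ⋂₀ 𝒩 = ⋂₀ 𝒩 := by
    apply Subset.antisymm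
    · rintro _ ⟨x, hx, rfl⟩ S hS
      exact hx _ (hpreimage S hS)
    · intro x hx
      refine ⟨f.symm x, fun S hS => ?_, f.apply_symm_apply x⟩
      obtain ⟨y, hy, rfl⟩ := hx _ (himage S hS)
      rwa [f.symm_apply_apply]
  have hinterM : ⋂₀ 𝒩 = M :=
    hMmin _ (sInter_subset_of_mem hM𝒩) hne (isClosed_sInter fun S hS => hS.2.1) hfix
  exact hNM.antisymm (hinterM ▸ sInter_subset_of_mem (⟨hNne, hNcl, hgN⟩ : N ∈ 𝒩))
end

section
/- Let X be a regular curve and f : X → X a homeomorphism. Then for every x ∈ X, if the set ω_f(x) ∪ α_f(x) is infinite, then ω_f(x) = α_f(x). -/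
open Set Filter Metric Topology

section RegularCurve

variable {X : Type*} [MetricSpace X]

/-- Regular continua are connected im kleinen: a clopen subset of `closure U` containing `x` and
meeting the finite set `frontier U` in as few points as possible is connected. -/
theorem exists_isPreconnected_mem_nhds [ConnectedSpace X] (hreg : regularCurveAx X)
    {x : X} {V : Set X} (hV : V ∈ 𝓝 x) :
    ∃ C ⊆ V, C ∈ 𝓝 x ∧ IsPreconnected C := by
  obtain ⟨W, hWx, hWc, hWV⟩ := exists_mem_nhds_isClosed_subset hV
  obtain ⟨U, hUo, hxU, hUW, hUf⟩ :=
    hreg x (interior W) isOpen_interior (mem_interior_iff_mem_nhds.2 hWx)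
  have hKV : closure U ⊆ V :=
    (closure_minimal (hUW.trans interior_subset) hWc).trans hWV
  set S : Set (Set X) :=
    {C | IsClosed C ∧ IsClosed (closure U \ C) ∧ C ⊆ closure U ∧ x ∈ C}
  have hSne : S.Nonempty :=
    ⟨closure U, isClosed_closure, by simp, subset_rfl, subset_closure hxU⟩
  obtain ⟨C, ⟨hC, hKC, hCK, hxC⟩, hmin⟩ :=
    exists_minimalFor_of_wellFoundedLT (· ∈ S) (fun C => (C ∩ frontier U).ncard) hSne
  refine ⟨C, hCK.trans hKV, ?_, ?_⟩
  · filter_upwards [hUo.mem_nhds hxU, hKC.isOpen_compl.mem_nhds (fun h => h.2 hxC)] with y hy hy'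
    by_contra h
    exact hy' ⟨subset_closure hy, h⟩
  · have key : ∀ t t' : Set X, IsClosed t → IsClosed t' → C ⊆ t ∪ t' → x ∈ t →
        (C ∩ t').Nonempty → (C ∩ (t ∩ t')).Nonempty := by
      intro t t' ht ht' hcov hxt hne
      by_contra hemp
      rw [not_nonempty_iff_eq_empty] at hemp
      have hdisj : ∀ y ∈ C, y ∈ t → y ∉ t' := fun y h1 h2 h3 =>
        (hemp ▸ (⟨h1, h2, h3⟩ : y ∈ C ∩ (t ∩ t')) : y ∈ (∅ : Set X))
      have hK' : closure U \ (C ∩ t) = (closure U \ C) ∪ (C ∩ t') := by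
        ext y
        constructor
        · rintro ⟨h1, h2⟩
          by_cases hyC : y ∈ C
          · exact Or.inr ⟨hyC, (hcov hyC).resolve_left fun h => h2 ⟨hyC, h⟩⟩
          · exact Or.inl ⟨h1, hyC⟩
        · rintro (⟨h1, h2⟩ | ⟨h1, h2⟩)
          · exact ⟨h1, fun h => h2 h.1⟩
          · exact ⟨hCK h1, fun h => hdisj y h1 h.2 h2⟩
      have hmem : C ∩ t ∈ S :=
        ⟨hC.inter ht, hK' ▸ hKC.union (hC.inter ht'), inter_subset_left.trans hCK, hxC, hxt⟩
      have hsub : (C ∩ t) ∩ frontier U ⊆ C ∩ frontier U :=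
        inter_subset_inter_left _ inter_subset_left
      have heq : (C ∩ t) ∩ frontier U = C ∩ frontier U :=
        Set.eq_of_subset_of_ncard_le hsub
          (hmin hmem (Set.ncard_le_ncard hsub (hUf.inter_of_right _))) (hUf.inter_of_right _)
      have hEU : C ∩ t' ⊆ U := by
        rintro y ⟨h1, h2⟩
        by_contra hyU
        have : y ∈ C ∩ frontier U := ⟨h1, by rw [hUo.frontier_eq]; exact ⟨hCK h1, hyU⟩⟩
        rw [← heq] at this
        exact hdisj y h1 this.1.2 h2
      have hKE : IsClosed (closure U \ (C ∩ t')) := by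
        have : closure U \ (C ∩ t') = (closure U \ C) ∪ (C ∩ t) := by
          ext y
          constructor
          · rintro ⟨h1, h2⟩
            by_cases hyC : y ∈ C
            · exact Or.inr ⟨hyC, (hcov hyC).resolve_right fun h => h2 ⟨hyC, h⟩⟩
            · exact Or.inl ⟨h1, hyC⟩
          · rintro (⟨h1, h2⟩ | ⟨h1, h2⟩)
            · exact ⟨h1, fun h => h2 h.1⟩
            · exact ⟨hCK h1, fun h => hdisj y h1 h2 h.2⟩
        exact this ▸ hKC.union (hC.inter ht)
      have hEo : IsOpen (C ∩ t') := by
        have : C ∩ t' = U ∩ (closure U \ (C ∩ t'))ᶜ := by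
          ext y
          refine ⟨fun h => ⟨hEU h, fun h' => h'.2 h⟩, fun h => ?_⟩
          by_contra h'
          exact h.2 ⟨subset_closure h.1, h'⟩
        exact this ▸ hUo.inter hKE.isOpen_compl
      have huniv : C ∩ t' = univ := IsClopen.eq_univ ⟨hC.inter ht', hEo⟩ hne
      exact hdisj x hxC hxt (huniv ▸ mem_univ x : x ∈ C ∩ t').2
    rw [isPreconnected_closed_iff]
    intro t t' ht ht' hcov h1 h2
    rcases hcov hxC with h | h
    · exact key t t' ht ht' hcov h h2
    · rw [inter_comm t t']
      exact key t' t ht' ht (by rwa [union_comm]) h h1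

theorem IsPreconnected.inter_frontier_nonempty_of_isOpen {C J : Set X} (hC : IsPreconnected C)
    (hJ : IsOpen J) (h1 : (C ∩ J).Nonempty) (h2 : (C \ J).Nonempty) :
    (C ∩ frontier J).Nonempty := by
  by_contra h
  rw [not_nonempty_iff_eq_empty] at h
  have hcov : C ⊆ J ∪ (closure J)ᶜ := by
    intro y hy
    by_contra hy'
    simp only [mem_union, mem_compl_iff, not_or, not_not] at hy'
    have : y ∈ C ∩ frontier J := ⟨hy, by rw [hJ.frontier_eq]; exact ⟨hy'.2, hy'.1⟩⟩
    simp [h] at this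
  obtain ⟨y, hyC, hyJ⟩ := h2
  obtain ⟨w, -, hw1, hw2⟩ := hC J (closure J)ᶜ hJ isClosed_closure.isOpen_compl hcov h1
    ⟨y, hyC, (hcov hyC).resolve_left hyJ⟩
  exact hw2 (subset_closure hw1)

/-- More than `#(frontier J)` distinct points have neighborhoods such that no homeomorphism can
send, for each of them, one point inside `J` and another point outside `J`. -/
theorem exists_nhds_forall_homeomorph [ConnectedSpace X] (hreg : regularCurveAx X) {J : Set X}
    (hJ : IsOpen J) (hJf : (frontier J).Finite) (s : Finset X)
    (hs : (frontier J).ncard < s.card) :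
    ∃ A : X → Set X, (∀ a ∈ s, A a ∈ 𝓝 a) ∧ ∀ (g : X ≃ₜ X) (u v : X → X),
      (∀ a ∈ s, u a ∈ A a) → (∀ a ∈ s, v a ∈ A a) → (∀ a ∈ s, g (u a) ∈ J) →
      ∃ a ∈ s, g (v a) ∈ J := by
  obtain ⟨V, hV, hVd⟩ := s.finite_toSet.t2_separation
  choose A hAV hA hAc using fun a =>
    exists_isPreconnected_mem_nhds hreg ((hV a).2.mem_nhds (hV a).1)
  refine ⟨A, fun a _ => hA a, fun g u v hu hv huJ => ?_⟩
  by_contra! hvJ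
  have hc : ∀ a ∈ s, ∃ c ∈ frontier J, g.symm c ∈ A a := by
    intro a ha
    obtain ⟨_, ⟨c, hcA, rfl⟩, hcJ⟩ :=
      ((hAc a).image g g.continuous.continuousOn).inter_frontier_nonempty_of_isOpen hJ
        ⟨g (u a), mem_image_of_mem g (hu a ha), huJ a ha⟩
        ⟨g (v a), mem_image_of_mem g (hv a ha), hvJ a ha⟩
    exact ⟨g c, hcJ, by simpa using hcA⟩
  choose! c hcJ hcA using hc
  have hinj : Set.InjOn c s := by
    intro a ha b hb hab
    by_contra hne
    exact Set.disjoint_left.1 (hVd ha hb hne) (hAV a (hcA a ha)) (hAV b (hab ▸ hcA b hb))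
  have := Set.ncard_le_ncard_of_injOn c (s := (s : Set X)) (t := frontier J)
    (fun a ha => hcJ a ha) hinj hJf
  rw [Set.ncard_coe_finset] at this
  omega

/-- The dynamical form of `exists_nhds_forall_homeomorph`, along one orbit. -/
theorem exists_nhds_forall_zpow [ConnectedSpace X] (hreg : regularCurveAx X) (f : X ≃ₜ X)
    {J : Set X} (hJ : IsOpen J) (hJf : (frontier J).Finite) {z : X}
    (hz : Function.Injective fun n : ℤ => (f ^ n) z) (D : Finset ℤ)
    (hD : (frontier J).ncard < D.card) :
    ∃ U ∈ 𝓝 z, ∀ N : ℤ, ∀ u ∈ U, ∀ v ∈ U, (∀ d ∈ D, (f ^ (N + d)) u ∈ J) →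
      ∃ d ∈ D, (f ^ (N + d)) v ∈ J := by
  classical
  obtain ⟨A, hA, h⟩ := exists_nhds_forall_homeomorph hreg hJ hJf (D.image fun n => (f ^ n) z)
    (by rwa [Finset.card_image_of_injective _ hz])
  refine ⟨⋂ d ∈ D, (f ^ d) ⁻¹' A ((f ^ d) z), ?_, fun N u hu v hv huJ => ?_⟩
  · rw [Filter.biInter_finset_mem]
    exact fun d hd => (f ^ d).continuous.continuousAt.preimage_mem_nhds
      (hA _ (Finset.mem_image_of_mem _ hd))
  · simp only [mem_iInter, mem_preimage] at hu hv
    have hinv : ∀ d, Function.invFun (fun n : ℤ => (f ^ n) z) ((f ^ d) z) = d :=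
      fun d => Function.leftInverse_invFun hz d
    obtain ⟨a, ha, haJ⟩ := h (f ^ N)
      (fun a => (f ^ Function.invFun (fun n : ℤ => (f ^ n) z) a) u)
      (fun a => (f ^ Function.invFun (fun n : ℤ => (f ^ n) z) a) v)
      (Finset.forall_mem_image.2 fun d hd => by simpa only [hinv] using hu d hd)
      (Finset.forall_mem_image.2 fun d hd => by simpa only [hinv] using hv d hd)
      (Finset.forall_mem_image.2 fun d hd => by
        simpa only [hinv, zpow_add, Homeomorph.mul_apply] using huJ d hd)
    obtain ⟨d, hd, rfl⟩ := Finset.mem_image.1 ha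
    exact ⟨d, hd, by simpa only [hinv, zpow_add, Homeomorph.mul_apply] using haJ⟩

theorem Homeomorph.coe_zpow_natCast (f : X ≃ₜ X) (n : ℕ) : ⇑(f ^ (n : ℤ)) = f^[n] := by
  rw [zpow_natCast]
  induction n with
  | zero => rfl
  | succ n ih => rw [pow_succ, Function.iterate_succ, ← ih]; rfl

theorem Homeomorph.zpow_apply_eq_self {g : X ≃ₜ X} {x : X} (h : g x = x) (n : ℤ) :
    (g ^ n) x = x := by
  induction n with
  | zero => rfl
  | succ n ih => rw [zpow_add_one, Homeomorph.mul_apply, h, ih]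
  | pred n ih =>
    have h' : g⁻¹ x = x := by
      rw [Homeomorph.inv_apply, Homeomorph.symm_apply_eq, h]
    rw [zpow_sub_one, Homeomorph.mul_apply, h', ih]

theorem mem_omegaSet_iff_s18 {f : X ≃ₜ X} {x y : X} :
    y ∈ omegaSet f x ↔ ∀ J ∈ 𝓝 y, ∀ m : ℕ, ∃ n : ℕ, m ≤ n ∧ (f ^ (n : ℤ)) x ∈ J := by
  simp only [Homeomorph.coe_zpow_natCast]
  constructor
  · rintro ⟨n, hn, hlim⟩ J hJ m
    obtain ⟨i, h1, h2⟩ := ((hn.tendsto_atTop.eventually_ge_atTop m).and (hlim hJ)).exists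
    exact ⟨n i, h1, h2⟩
  · intro h
    have : MapClusterPt y atTop fun n => f^[n] x :=
      mapClusterPt_iff_frequently.2 fun s hs => frequently_atTop.2 (h s hs)
    exact this.tendsto_subseq

theorem mem_omegaSet_symm_iff {f : X ≃ₜ X} {x y : X} :
    y ∈ omegaSet f.symm x ↔ ∀ J ∈ 𝓝 y, ∀ m : ℕ, ∃ n : ℕ, m ≤ n ∧ (f ^ (-(n : ℤ))) x ∈ J := by
  have h : f.symm = f⁻¹ := rfl
  simp only [mem_omegaSet_iff_s18, h, inv_zpow']

theorem infinite_zpow_mem {f : X ≃ₜ X} {x q : X} {J : Set X} (hJ : J ∈ 𝓝 q)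
    (hq : q ∈ omegaSet f x ∪ omegaSet f.symm x) : {d : ℤ | (f ^ d) x ∈ J}.Infinite := by
  rcases hq with hq | hq
  · refine Set.infinite_of_forall_exists_gt fun a => ?_
    obtain ⟨n, hn, h⟩ := mem_omegaSet_iff_s18.1 hq J hJ (a.toNat + 1)
    exact ⟨n, h, by omega⟩
  · refine Set.infinite_of_forall_exists_lt fun a => ?_
    obtain ⟨n, hn, h⟩ := mem_omegaSet_symm_iff.1 hq J hJ ((-a).toNat + 1)
    exact ⟨-n, h, by omega⟩

theorem omegaSet_symm_subset_of_mem {f : X ≃ₜ X} {x e : X} (he : e ∈ omegaSet f x) :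
    omegaSet f.symm e ⊆ omegaSet f x := by
  intro q hq
  rw [mem_omegaSet_iff_s18]
  intro J hJ m
  obtain ⟨n, -, hn⟩ := mem_omegaSet_symm_iff.1 hq _ (interior_mem_nhds.2 hJ) 0
  obtain ⟨k, hk, h⟩ := mem_omegaSet_iff_s18.1 he _
    ((f ^ (-(n : ℤ))).continuous.continuousAt.preimage_mem_nhds
      (isOpen_interior.mem_nhds hn)) (m + n)
  refine ⟨k - n, by omega, interior_subset ?_⟩
  rw [mem_preimage, ← Homeomorph.mul_apply, ← zpow_add] at h
  rwa [Nat.cast_sub (by omega), sub_eq_neg_add]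

theorem regularCurveAx.exists_closure_subset (hreg : regularCurveAx X) {x : X} {V : Set X}
    (hV : V ∈ 𝓝 x) : ∃ J, IsOpen J ∧ x ∈ J ∧ closure J ⊆ V ∧ (frontier J).Finite := by
  obtain ⟨W, hWx, hWc, hWV⟩ := exists_mem_nhds_isClosed_subset hV
  obtain ⟨J, hJo, hxJ, hJW, hJf⟩ :=
    hreg x (interior W) isOpen_interior (mem_interior_iff_mem_nhds.2 hWx)
  exact ⟨J, hJo, hxJ, (closure_minimal (hJW.trans interior_subset) hWc).trans hWV, hJf⟩

/-- Every limit point of the orbit of `x` is an α-limit point of every nonperiodic point of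
`ω_f(x)`. -/
theorem union_subset_omegaSet_symm_of_mem [ConnectedSpace X] (hreg : regularCurveAx X)
    {f : X ≃ₜ X} {x e : X} (he : e ∈ omegaSet f x)
    (hinj : Function.Injective fun n : ℤ => (f ^ n) e) :
    omegaSet f x ∪ omegaSet f.symm x ⊆ omegaSet f.symm e := by
  intro q hq
  rw [mem_omegaSet_symm_iff]
  intro V hV m
  obtain ⟨J, hJ, hqJ, hJV, hJf⟩ := hreg.exists_closure_subset hV
  obtain ⟨D, hDJ, hD⟩ := (infinite_zpow_mem (hJ.mem_nhds hqJ) hq).exists_subset_card_eq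
    ((frontier J).ncard + 1)
  obtain ⟨U, hU, h⟩ := exists_nhds_forall_zpow hreg f hJ hJf hinj D (by omega)
  obtain ⟨n, hn, hnU⟩ := mem_omegaSet_iff_s18.1 he U hU (m + D.sup Int.natAbs)
  obtain ⟨d, hd, hdJ⟩ := h (-n) _ hnU e (mem_of_mem_nhds hU) fun d hd => by
    rw [← Homeomorph.mul_apply, ← zpow_add, neg_add_cancel_comm]
    exact hDJ hd
  have hdn : d.natAbs ≤ D.sup Int.natAbs := Finset.le_sup hd
  refine ⟨(n - d).toNat, by omega, hJV (subset_closure ?_)⟩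
  rwa [show -(((n - d).toNat : ℕ) : ℤ) = -n + d by omega]

/-- Nonperiodic points of `ω_f(x)` belong to `α_f(x)`. -/
theorem mem_omegaSet_symm_of_mem_omegaSet [ConnectedSpace X] (hreg : regularCurveAx X)
    {f : X ≃ₜ X} {x e : X} (he : e ∈ omegaSet f x)
    (hinj : Function.Injective fun n : ℤ => (f ^ n) e) : e ∈ omegaSet f.symm x := by
  have hee : e ∈ omegaSet f.symm e := union_subset_omegaSet_symm_of_mem hreg he hinj (Or.inl he)
  rw [mem_omegaSet_symm_iff]
  intro V hV m
  obtain ⟨J, hJ, heJ, hJV, hJf⟩ := hreg.exists_closure_subset hV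
  obtain ⟨D, hDJ, hD⟩ := (infinite_zpow_mem (hJ.mem_nhds heJ) (Or.inr hee)).exists_subset_card_eq
    ((frontier J).ncard + 1)
  obtain ⟨U, hU, h⟩ := exists_nhds_forall_zpow hreg f hJ hJf hinj D (by omega)
  obtain ⟨n, -, hnU⟩ := mem_omegaSet_iff_s18.1 he U hU 0
  have hnear : ⋂ d ∈ D, (f ^ d) ⁻¹' J ∈ 𝓝 e := by
    rw [Filter.biInter_finset_mem]
    exact fun d hd => (f ^ d).continuous.continuousAt.preimage_mem_nhds (hJ.mem_nhds (hDJ hd))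
  obtain ⟨N, hN, hNJ⟩ := mem_omegaSet_symm_iff.1 hee _ hnear (m + n + D.sup Int.natAbs)
  simp only [mem_iInter, mem_preimage] at hNJ
  obtain ⟨d, hd, hdJ⟩ := h (-N) e (mem_of_mem_nhds hU) _ hnU fun d hd => by
    rw [add_comm, zpow_add, Homeomorph.mul_apply]
    exact hNJ d hd
  have hdn : d.natAbs ≤ D.sup Int.natAbs := Finset.le_sup hd
  rw [← Homeomorph.mul_apply, ← zpow_add] at hdJ
  refine ⟨(N - d - n).toNat, by omega, hJV (subset_closure ?_)⟩
  rwa [show -(((N - d - n).toNat : ℕ) : ℤ) = -N + d + n by omega]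

theorem exists_zpow_eq_self_of_not_injective {f : X ≃ₜ X} {e : X}
    (h : ¬ Function.Injective fun n : ℤ => (f ^ n) e) :
    ∃ p : ℕ, 0 < p ∧ (f ^ (p : ℤ)) e = e := by
  have key : ∀ a b : ℤ, a < b → (f ^ a) e = (f ^ b) e → ∃ p : ℕ, 0 < p ∧ (f ^ (p : ℤ)) e = e := by
    intro a b hab heq
    refine ⟨(b - a).toNat, by omega, ?_⟩
    apply (f ^ a).injective
    rw [← Homeomorph.mul_apply, ← zpow_add, heq]
    congr 2
    omega
  simp only [Function.Injective, not_forall] at h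
  obtain ⟨a, b, heq, hne⟩ := h
  rcases lt_or_gt_of_ne hne with h | h
  · exact key a b h heq
  · exact key b a h heq.symm

theorem finite_range_zpow {f : X ≃ₜ X} {e : X} {p : ℕ} (hp : 0 < p)
    (he : (f ^ (p : ℤ)) e = e) : (range fun n : ℤ => (f ^ n) e).Finite := by
  refine ((Finset.Ico (0 : ℤ) p).finite_toSet.image fun n => (f ^ n) e).subset ?_
  rintro _ ⟨n, rfl⟩
  refine ⟨n % p, ?_, ?_⟩
  · simp only [Finset.coe_Ico, mem_Ico]
    exact ⟨Int.emod_nonneg _ (by omega), Int.emod_lt_of_pos _ (by omega)⟩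
  · have : (f ^ n) e = (f ^ (n % p)) ((f ^ (p * (n / p))) e) := by
      rw [← Homeomorph.mul_apply, ← zpow_add, Int.emod_add_mul_ediv]
    simp only [this, zpow_mul, Homeomorph.zpow_apply_eq_self he]

/-- If `ω_f(x)` contains infinitely many points, all of them periodic, near `z`, then `z` lies in
the orbit of every periodic point of `ω_f(x)`. -/
theorem mem_range_zpow_of_infinite [ConnectedSpace X] (hreg : regularCurveAx X)
    {f : X ≃ₜ X} {x z : X}
    (hper : ∀ e ∈ omegaSet f x, ∃ p : ℕ, 0 < p ∧ (f ^ (p : ℤ)) e = e)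
    (hz : ∀ J ∈ 𝓝 z, (J ∩ omegaSet f x).Infinite) {q : X} (hq : q ∈ omegaSet f x) :
    z ∈ range fun n : ℤ => (f ^ n) q := by
  by_contra hzq
  choose! p hp hpe using hper
  have hfin := finite_range_zpow (hp q hq) (hpe q hq)
  obtain ⟨J, hJ, hzJ, hJV, hJf⟩ :=
    hreg.exists_closure_subset (hfin.isClosed.isOpen_compl.mem_nhds hzq)
  obtain ⟨s, hsJ, hs⟩ := (hz J (hJ.mem_nhds hzJ)).exists_subset_card_eq ((frontier J).ncard + 1)
  obtain ⟨A, hA, h⟩ := exists_nhds_forall_homeomorph hreg hJ hJf s (by omega)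
  have hvis : ∀ a ∈ s, ∃ n : ℕ, (f ^ (n : ℤ)) x ∈ A a := fun a ha =>
    (mem_omegaSet_iff_s18.1 (hsJ ha).2 _ (hA a ha) 0).imp fun _ hn => hn.2
  choose! t ht using hvis
  set P : ℕ := ∏ a ∈ s, p a with hP
  have hPpos : 0 < P := Finset.prod_pos fun a ha => hp a (hsJ ha).2
  have hPfix : ∀ a ∈ s, ∀ m : ℤ, (f ^ (P * m)) a = a := by
    intro a ha m
    obtain ⟨k, hk⟩ := Finset.dvd_prod_of_mem p ha
    rw [hP, hk, Nat.cast_mul, mul_assoc, zpow_mul]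
    exact Homeomorph.zpow_apply_eq_self (hpe a (hsJ ha).2) _
  have hvisJ : ∀ m : ℤ, ∃ a ∈ s, (f ^ (P * m + t a)) x ∈ J := fun m => by
    simpa only [zpow_add, Homeomorph.mul_apply] using
      h (f ^ (P * m)) id (fun a => (f ^ (t a : ℤ)) x)
        (fun a ha => mem_of_mem_nhds (hA a ha)) ht
        (fun a ha => by simpa only [id, hPfix a ha m] using (hsJ ha).1)
  have hnear : ⋂ j ∈ Finset.range (P + s.sup t + 1), (f ^ (j : ℤ)) ⁻¹' (closure J)ᶜ ∈ 𝓝 q := by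
    rw [Filter.biInter_finset_mem]
    exact fun j _ => (f ^ (j : ℤ)).continuous.continuousAt.preimage_mem_nhds
      (isClosed_closure.isOpen_compl.mem_nhds fun hj => hJV hj ⟨j, rfl⟩)
  obtain ⟨n, -, hn⟩ := mem_omegaSet_iff_s18.1 hq _ hnear 0
  simp only [mem_iInter, mem_preimage, Finset.mem_range] at hn
  obtain ⟨a, ha, haJ⟩ := hvisJ ((n / P : ℕ) + 1)
  have hta : t a ≤ s.sup t := Finset.le_sup ha
  have h1 := Nat.div_add_mod n P
  have h2 := Nat.mod_lt n hPpos
  refine hn (P - n % P + t a) (by omega) (subset_closure ?_)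
  rw [← Homeomorph.mul_apply, ← zpow_add]
  convert haJ using 3
  rw [mul_add, mul_one, ← Nat.cast_mul]
  omega

theorem exists_injective_zpow_of_infinite [CompactSpace X] [ConnectedSpace X]
    (hreg : regularCurveAx X) {f : X ≃ₜ X} {x : X} (hinf : (omegaSet f x).Infinite) :
    ∃ e ∈ omegaSet f x, Function.Injective fun n : ℤ => (f ^ n) e := by
  by_contra! hcon
  have hper := fun e he => exists_zpow_eq_self_of_not_injective (hcon e he)
  obtain ⟨z, hz⟩ := hinf.exists_accPt_cofinite_inf_principal
  have hz' : ∀ J ∈ 𝓝 z, (J ∩ omegaSet f x).Infinite := by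
    intro J hJ hfin
    have := clusterPt_iff_frequently.1 hz.clusterPt J hJ
    rw [frequently_inf_principal, frequently_cofinite_iff_infinite] at this
    exact this (hfin.subset fun y hy => ⟨hy.2, hy.1⟩)
  have hmem := fun q hq => mem_range_zpow_of_infinite hreg hper hz' (q := q) hq
  obtain ⟨q, hq⟩ := hinf.nonempty
  obtain ⟨p, hp, hpq⟩ := hper q hq
  refine hinf ((finite_range_zpow hp hpq).subset fun w hw => ?_)
  obtain ⟨a, ha⟩ := hmem q hq
  obtain ⟨b, hb⟩ := hmem w hw
  refine ⟨-b + a, ?_⟩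
  simp only at ha hb
  simp only [zpow_add, Homeomorph.mul_apply, ha, ← hb]
  rw [← Homeomorph.mul_apply, ← zpow_add, neg_add_cancel, zpow_zero, Homeomorph.one_apply]

theorem omegaSet_eq_omegaSet_symm_of_infinite [CompactSpace X] [ConnectedSpace X]
    (hreg : regularCurveAx X) {f : X ≃ₜ X} {x : X} (hinf : (omegaSet f x).Infinite) :
    omegaSet f x = omegaSet f.symm x := by
  obtain ⟨e, he, hinj⟩ := exists_injective_zpow_of_infinite hreg hinf
  have he' := mem_omegaSet_symm_of_mem_omegaSet hreg he hinj
  have hinj' : Function.Injective fun n : ℤ => (f.symm ^ n) e := by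
    have h : f.symm = f⁻¹ := rfl
    simp only [h, inv_zpow']
    exact hinj.comp neg_injective
  apply Subset.antisymm
  · exact (subset_union_right.trans
      (union_subset_omegaSet_symm_of_mem (f := f.symm) hreg he' hinj')).trans
      (omegaSet_symm_subset_of_mem (f := f.symm) he')
  · exact (subset_union_right.trans (union_subset_omegaSet_symm_of_mem hreg he hinj)).trans
      (omegaSet_symm_subset_of_mem he)

end RegularCurve

/-- For a homeomorphism of a regular curve, if ω_f(x) ∪ α_f(x) is infinite then
ω_f(x) = α_f(x). -/
theorem omegaSet_eq_alphaSet_of_infinite {X : Type*} [MetricSpace X] [Nonempty X]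
    [CompactSpace X] [ConnectedSpace X] (hreg : regularCurveAx X) (f : X ≃ₜ X) :
    ∀ x : X, (omegaSet (⇑f) x ∪ omegaSet (⇑f.symm) x).Infinite →
      omegaSet (⇑f) x = omegaSet (⇑f.symm) x := by
  intro x hinf
  rcases Set.infinite_union.1 hinf with h | h
  · exact omegaSet_eq_omegaSet_symm_of_infinite hreg h
  · exact (omegaSet_eq_omegaSet_symm_of_infinite (f := f.symm) hreg h).symm
end

section
/- Let X be a regular curve, f : X → X a homeomorphism, M an infinite minimal set of f, and U an open neighborhood of M whose boundary ∂U is finite, with k = card(∂U). Then there exists an open neighborhood V of M with V ⊆ U such that for every x ∈ V and every integer n ∈ ℤ, the set {f^n(x), f^{n+1}(x), …, f^{n+k}(x)} meets U. -/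
open Set Filter Metric Topology

theorem IsPreconnected.inter_frontier_nonempty_s19 {X : Type*} [TopologicalSpace X] {s u : Set X}
    (hs : IsPreconnected s) (hsu : (s ∩ u).Nonempty) (hsu' : (s ∩ uᶜ).Nonempty) :
    (s ∩ frontier u).Nonempty := by
  by_contra h
  have hfr : ∀ x ∈ s, x ∈ closure u → x ∈ interior u := fun x hx hxu => by
    by_contra hxi
    exact h ⟨x, hx, hxu, hxi⟩
  obtain ⟨x, hx, hxu⟩ := hsu
  obtain ⟨z, hz, hzu⟩ := hsu'
  obtain ⟨w, -, hwi, hwc⟩ := hs (interior u) (closure u)ᶜ isOpen_interior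
    isClosed_closure.isOpen_compl (fun w hw => or_iff_not_imp_right.2 fun hwc =>
      hfr w hw (not_not.1 hwc)) ⟨x, hx, hfr x hx (subset_closure hxu)⟩
    ⟨z, hz, fun hzc => hzu (interior_subset (hfr z hz hzc))⟩
  exact hwc (subset_closure (interior_subset hwi))

theorem exists_isPreconnected_mem_nhds_subset_closure {X : Type*} [TopologicalSpace X]
    [PreconnectedSpace X] {U : Set X} (hU : IsOpen U) (hfin : (frontier U).Finite)
    {y : X} (hy : y ∈ U) :
    ∃ Q : Set X, IsPreconnected Q ∧ Q ∈ 𝓝 y ∧ Q ⊆ closure U := by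
  -- A relatively clopen piece of `closure U` meeting the frontier as little as possible.
  obtain ⟨Q, ⟨hQU, hyQ, hQ, hQ'⟩, hmin⟩ := exists_minimalFor_of_wellFoundedLT
    (fun Q : Set X => Q ⊆ closure U ∧ y ∈ Q ∧ IsClosed Q ∧ IsClosed (closure U \ Q))
    (fun Q => (Q ∩ frontier U).ncard)
    ⟨closure U, subset_rfl, subset_closure hy, isClosed_closure, by simp⟩
  have key : ∀ u v : Set X, IsClosed u → IsClosed v → Q ⊆ u ∪ v → Disjoint u v → y ∈ u →
      Q ⊆ u := by
    intro u v hu hv huv hd hyu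
    have huv' : ∀ x ∈ u, x ∉ v := fun _ hx => Set.disjoint_left.1 hd hx
    have hle : (Q ∩ frontier U).ncard ≤ (Q ∩ u ∩ frontier U).ncard := by
      have hsub : Q ∩ u ∩ frontier U ⊆ Q ∩ frontier U := by gcongr; exact inter_subset_left
      refine hmin ⟨inter_subset_left.trans hQU, ⟨hyQ, hyu⟩, hQ.inter hu, ?_⟩
        (Set.ncard_le_ncard hsub (hfin.subset inter_subset_right))
      have : closure U \ (Q ∩ u) = (closure U \ Q) ∪ (Q ∩ v) := by
        ext x
        constructor
        · rintro ⟨hxU, hx⟩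
          by_cases hxQ : x ∈ Q
          · exact Or.inr ⟨hxQ, (huv hxQ).resolve_left fun hxu => hx ⟨hxQ, hxu⟩⟩
          · exact Or.inl ⟨hxU, hxQ⟩
        · rintro (⟨hxU, hxQ⟩ | ⟨hxQ, hxv⟩)
          · exact ⟨hxU, fun h => hxQ h.1⟩
          · exact ⟨hQU hxQ, fun h => huv' x h.2 hxv⟩
      rw [this]
      exact hQ'.union (hQ.inter hv)
    have heq : Q ∩ u ∩ frontier U = Q ∩ frontier U :=
      Set.eq_of_subset_of_ncard_le (by gcongr; exact inter_subset_left) hle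
        (hfin.subset inter_subset_right)
    have hopen : Q ∩ v = U ∩ ((closure U \ Q) ∪ (Q ∩ u))ᶜ := by
      ext x
      constructor
      · rintro ⟨hxQ, hxv⟩
        have hxU : x ∈ U := by
          by_contra hxU
          have hxF : x ∈ Q ∩ frontier U := ⟨hxQ, hU.frontier_eq ▸ ⟨hQU hxQ, hxU⟩⟩
          exact huv' x (heq.symm.subset hxF).1.2 hxv
        exact ⟨hxU, fun h => h.elim (fun h => h.2 hxQ) fun h => huv' x h.2 hxv⟩
      · rintro ⟨hxU, hx⟩
        have hxQ : x ∈ Q := by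
          by_contra hxQ
          exact hx (Or.inl ⟨subset_closure hxU, hxQ⟩)
        exact ⟨hxQ, (huv hxQ).resolve_left fun hxu => hx (Or.inr ⟨hxQ, hxu⟩)⟩
    have hclopen : IsClopen (Q ∩ v) :=
      ⟨hQ.inter hv, hopen ▸ hU.inter (hQ'.union (hQ.inter hu)).isOpen_compl⟩
    rcases isClopen_iff.1 hclopen with h | h
    · intro x hx
      exact (huv hx).resolve_right fun hxv => h.subset ⟨hx, hxv⟩
    · exact absurd (h.symm.subset (mem_univ y)).2 (huv' y hyu)
  refine ⟨Q, (isPreconnected_iff_subset_of_fully_disjoint_closed hQ).2 ?_, ?_, hQU⟩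
  · intro u v hu hv huv hd
    rcases huv hyQ with h | h
    · exact Or.inl (key u v hu hv huv hd h)
    · exact Or.inr (key v u hv hu (by rwa [union_comm]) hd.symm h)
  · filter_upwards [hU.mem_nhds hy, hQ'.isOpen_compl.mem_nhds fun h => h.2 hyQ] with x hxU hx
    by_contra hxQ
    exact hx ⟨subset_closure hxU, hxQ⟩

theorem IsMinimalSet.not_isPeriodicPt {X : Type*} [MetricSpace X] {f : X → X} {M : Set X}
    (hM : IsMinimalSet f M) (hinf : M.Infinite) {y : X} (hy : y ∈ M) {d : ℕ} (hd : 0 < d) :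
    ¬ Function.IsPeriodicPt f d y := by
  intro hp
  obtain ⟨-, -, himg, hmin⟩ := hM
  have hfin : (range fun i : ℕ => f^[i] y).Finite := by
    refine ((Finset.range d).finite_toSet.image fun i : ℕ => f^[i] y).subset ?_
    rintro _ ⟨i, rfl⟩
    exact ⟨i % d, by simpa using Nat.mod_lt i hd, hp.iterate_mod_apply i⟩
  have hsub : (range fun i : ℕ => f^[i] y) ⊆ M := by
    rintro _ ⟨i, rfl⟩
    exact (mapsTo_iff_image_subset.2 himg.subset).iterate i hy
  refine hinf ((hmin _ hsub (range_nonempty _) hfin.isClosed ?_) ▸ hfin)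
  refine Subset.antisymm ?_ ?_
  · rintro _ ⟨_, ⟨i, rfl⟩, rfl⟩
    exact ⟨i + 1, Function.iterate_succ_apply' f i y⟩
  · rintro _ ⟨i, rfl⟩
    refine ⟨_, ⟨i + (d - 1), rfl⟩, ?_⟩
    have h : (i + (d - 1)).succ = i + d := by omega
    change f (f^[i + (d - 1)] y) = f^[i] y
    rw [← Function.iterate_succ_apply' f, h, Function.iterate_add_apply, hp.eq]

theorem eventually_smallSets_disjoint_iterate {X : Type*} [TopologicalSpace X] [T2Space X]
    {f : X → X} (hf : Continuous f) {y : X} {k : ℕ}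
    (hy : ∀ d, 0 < d → d ≤ k → ¬ Function.IsPeriodicPt f d y) :
    ∀ᶠ B in (𝓝 y).smallSets, ∀ d, 0 < d → d ≤ k → ∀ z ∈ B, f^[d] z ∉ B := by
  have h : ∀ d ∈ Finset.Ioc 0 k, ∀ᶠ B in (𝓝 y).smallSets, ∀ z ∈ B, f^[d] z ∉ B := by
    intro d hd
    rw [Finset.mem_Ioc] at hd
    obtain ⟨s, t, hs, ht, hst⟩ := t2_separation_nhds (hy d hd.1 hd.2)
    refine eventually_smallSets.2
      ⟨t ∩ f^[d] ⁻¹' s, inter_mem ht ((hf.iterate d).continuousAt hs), fun B hB z hz hz' => ?_⟩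
    exact Set.disjoint_left.1 hst (hB hz).2 (hB hz').1
  filter_upwards [(Filter.eventually_all_finset _).2 h] with B hB d hd hdk
  exact hB d (Finset.mem_Ioc.2 ⟨hd, hdk⟩)

theorem Homeomorph.continuous_toEquiv_zpow {X : Type*} [TopologicalSpace X] (f : X ≃ₜ X)
    (n : ℤ) : Continuous ⇑((f.toEquiv : Equiv.Perm X) ^ n) := by
  cases n with
  | ofNat n =>
    rw [Int.ofNat_eq_natCast, zpow_natCast, ← Equiv.Perm.iterate_eq_pow]
    exact f.continuous.iterate n
  | negSucc n =>
    rw [zpow_negSucc, ← inv_pow, ← Equiv.Perm.iterate_eq_pow]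
    exact f.symm.continuous.iterate (n + 1)

theorem Equiv.Perm.zpow_apply_mem_of_image_eq {X : Type*} {f : Equiv.Perm X} {M : Set X}
    (h : f '' M = M) (n : ℤ) {y : X} (hy : y ∈ M) : (f ^ n) y ∈ M := by
  have hmaps : MapsTo f M M := mapsTo_iff_image_subset.2 h.subset
  have hinv : MapsTo (f⁻¹ : Equiv.Perm X) M M := by
    intro x hx
    obtain ⟨z, hz, rfl⟩ := h.symm.subset hx
    simpa using hz
  cases n with
  | ofNat n =>
    rw [Int.ofNat_eq_natCast, zpow_natCast, ← Equiv.Perm.iterate_eq_pow]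
    exact hmaps.iterate n hy
  | negSucc n =>
    rw [zpow_negSucc, ← inv_pow, ← Equiv.Perm.iterate_eq_pow]
    exact hinv.iterate (n + 1) hy

/-- If M is an infinite minimal set and U an open neighborhood of M with finite
boundary of cardinality k, then there is an open neighborhood V ⊆ U of M such that
for every x ∈ V and every n ∈ ℤ, the set {fⁿ(x), …, f^{n+k}(x)} meets U. -/
theorem exists_nbhd_orbit_visits {X : Type*} [MetricSpace X] [Nonempty X]
    [CompactSpace X] [ConnectedSpace X] (hreg : regularCurveAx X) (f : X ≃ₜ X)
    (M : Set X) (hM : IsMinimalSet (⇑f) M) (hMinf : M.Infinite)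
    (U : Set X) (hU : IsOpen U) (hMU : M ⊆ U) (hfin : (frontier U).Finite)
    (k : ℕ) (hk : (frontier U).ncard = k) :
    ∃ V : Set X, IsOpen V ∧ M ⊆ V ∧ V ⊆ U ∧
      ∀ x ∈ V, ∀ n : ℤ, ∃ i : ℕ, i ≤ k ∧ (f.toEquiv ^ (n + i)) x ∈ U := by
  let S : Set X := {x | ∃ A : Set X, IsPreconnected A ∧ x ∈ A ∧ (A ∩ M).Nonempty ∧
    ∀ d, 0 < d → d ≤ k → ∀ z ∈ A, f^[d] z ∉ A}
  refine ⟨interior S ∩ U, isOpen_interior.inter hU, fun y hy => ⟨?_, hMU hy⟩,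
    inter_subset_right, ?_⟩
  · obtain ⟨B, hB, hBdisj⟩ := eventually_smallSets.1
      (eventually_smallSets_disjoint_iterate (k := k) f.continuous
        fun d hd _ => hM.not_isPeriodicPt hMinf hy hd)
    obtain ⟨C, hC, hCc, hCB⟩ := exists_mem_nhds_isClosed_subset hB
    obtain ⟨W, hW, hyW, hWC, hWfin⟩ :=
      hreg y (interior C) isOpen_interior (mem_interior_iff_mem_nhds.2 hC)
    obtain ⟨Q, hQ, hQy, hQW⟩ := exists_isPreconnected_mem_nhds_subset_closure hW hWfin hyW
    have hQB : Q ⊆ B :=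
      (hQW.trans (closure_minimal (hWC.trans interior_subset) hCc)).trans hCB
    refine mem_interior_iff_mem_nhds.2 (mem_of_superset hQy fun x hx => ?_)
    exact ⟨Q, hQ, hx, ⟨y, mem_of_mem_nhds hQy, hy⟩, hBdisj Q hQB⟩
  · rintro x ⟨hxS, -⟩ n
    obtain ⟨A, hA, hxA, ⟨y, hyA, hyM⟩, hAdisj⟩ := interior_subset hxS
    by_contra! hout
    have hmeet : ∀ i ∈ Finset.range (k + 1),
        ∃ a ∈ A, (f.toEquiv ^ (n + (i : ℤ))) a ∈ frontier U := by
      intro i hi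
      have hconn := hA.image _ (f.continuous_toEquiv_zpow (n + i)).continuousOn
      obtain ⟨_, ⟨a, ha, rfl⟩, haU⟩ := hconn.inter_frontier_nonempty_s19 (u := U)
        ⟨_, mem_image_of_mem _ hyA,
          hMU (Equiv.Perm.zpow_apply_mem_of_image_eq hM.2.2.1 (n + i) hyM)⟩
        ⟨_, mem_image_of_mem _ hxA, hout i (Nat.lt_succ_iff.1 (Finset.mem_range.1 hi))⟩
      exact ⟨a, ha, haU⟩
    choose! a haA haU using hmeet
    obtain ⟨i, hi, j, hj, hij, heq⟩ := Finset.exists_ne_map_eq_of_card_lt_of_maps_to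
      (s := Finset.range (k + 1)) (t := hfin.toFinset)
      (f := fun i => (f.toEquiv ^ (n + (i : ℤ))) (a i))
      (by rw [← Set.ncard_eq_toFinset_card _ hfin, hk, Finset.card_range]; exact k.lt_succ_self)
      (fun i hi => by simpa using haU i (by simpa using hi))
    have hreturn : ∀ i j : ℕ, i < j → j ≤ k → a i ∈ A → a j ∈ A →
        (f.toEquiv ^ (n + (i : ℤ))) (a i) = (f.toEquiv ^ (n + (j : ℤ))) (a j) → False := by
      intro i j hij hj hai haj heq
      obtain ⟨d, rfl⟩ := Nat.exists_eq_add_of_lt hij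
      have hsplit : n + ((i + d + 1 : ℕ) : ℤ) = (n + i) + ((d + 1 : ℕ) : ℤ) := by
        push_cast; ring
      rw [hsplit, zpow_add _ (n + (i : ℤ)), zpow_natCast, Equiv.Perm.mul_apply, Equiv.apply_eq_iff_eq,
        ← Equiv.Perm.iterate_eq_pow] at heq
      exact hAdisj (d + 1) d.succ_pos (by omega) _ haj (heq ▸ hai)
    have hik := Nat.lt_succ_iff.1 (Finset.mem_range.1 hi)
    have hjk := Nat.lt_succ_iff.1 (Finset.mem_range.1 hj)
    rcases hij.lt_or_gt with h | h
    · exact hreturn i j h hjk (haA i hi) (haA j hj) heq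
    · exact hreturn j i h hik (haA j hj) (haA i hi) heq.symm
end
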